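/- arXiv:1809.00761 — 11 statements merged into one kernel-verified Lean document; each statement's English description precedes it below -/
import Mathlib

section
/- Let X be a real Hilbert space, let A: X ⇒ X be α-monotone, and let γ > 0 with 1 + γα > 0. Then the resolvent J_{γA} has full domain (i.e., for every x ∈ X there exists a ∈ X with x − a ∈ γ·A a) if and only if A is maximally α-monotone. -/
open Pointwise RealInnerProductSpace Filter

variable {X : Type*} [NormedAddCommGroup X] [InnerProductSpace ℝ X]

/-- `A` is `α`-monotone: `⟪x - y, u - v⟫ ≥ α‖x - y‖²` for all `(x,u), (y,v)` in the graph. -/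
def AlphaMonotone (α : ℝ) (A : X → Set X) : Prop :=
  ∀ ⦃x y u v : X⦄, u ∈ A x → v ∈ A y → α * ‖x - y‖ ^ 2 ≤ ⟪x - y, u - v⟫

/-- `A` is maximally `α`-monotone: it is `α`-monotone and no `α`-monotone operator has a graph
properly containing the graph of `A`. -/
def MaxAlphaMonotone (α : ℝ) (A : X → Set X) : Prop :=
  AlphaMonotone α A ∧
    ∀ B : X → Set X, AlphaMonotone α B → (∀ x, A x ⊆ B x) → ∀ x, B x ⊆ A x

/-- The convex function `(p, c) ↦ ‖p‖² / 4 + c` attains its minimum on a nonempty closed convex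
set on which it is bounded below. -/
theorem exists_isMinOn_norm_sq_add [CompleteSpace X] {K : Set (X × ℝ)} (hne : K.Nonempty)
    (hcl : IsClosed K) (hK : Convex ℝ K) {b : ℝ} (hb : ∀ z ∈ K, b ≤ ‖z.1‖ ^ 2 / 4 + z.2) :
    ∃ z ∈ K, IsMinOn (fun z : X × ℝ => ‖z.1‖ ^ 2 / 4 + z.2) K z := by
  set D : X × ℝ → ℝ := fun z => ‖z.1‖ ^ 2 / 4 + z.2 with hD
  have hbdd : BddBelow (D '' K) := ⟨b, by rintro _ ⟨z, hz, rfl⟩; exact hb z hz⟩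
  set m := sInf (D '' K)
  have hm : ∀ z ∈ K, m ≤ D z := fun z hz => csInf_le hbdd ⟨z, hz, rfl⟩
  have hseq : ∀ n : ℕ, ∃ z ∈ K, D z < m + 1 / ((n : ℝ) + 1) := fun n => by
    obtain ⟨_, ⟨z, hz, rfl⟩, h⟩ := exists_lt_of_csInf_lt (hne.image D)
      (lt_add_of_pos_right m (Nat.one_div_pos_of_nat (n := n) (α := ℝ)))
    exact ⟨z, hz, h⟩
  choose u huK hu using hseq
  have hpar : ∀ z ∈ K, ∀ w ∈ K, ‖z.1 - w.1‖ ^ 2 ≤ 8 * ((D z - m) + (D w - m)) := by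
    intro z hz w hw
    have hmid := hm _ (hK hz hw (by norm_num : (0 : ℝ) ≤ 1 / 2) (by norm_num : (0 : ℝ) ≤ 1 / 2)
      (by norm_num))
    have hn : ‖(1 / 2 : ℝ) • z.1 + (1 / 2 : ℝ) • w.1‖ ^ 2 = ‖z.1 + w.1‖ ^ 2 / 4 := by
      rw [← smul_add, norm_smul, mul_pow]; norm_num; ring
    have hp := parallelogram_law_with_norm ℝ z.1 w.1
    simp only [hD, Prod.fst_add, Prod.snd_add, Prod.smul_fst, Prod.smul_snd, smul_eq_mul,
      hn] at hmid ⊢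
    nlinarith
  have hone := tendsto_one_div_add_atTop_nhds_zero_nat (𝕜 := ℝ)
  have hcau : CauchySeq fun n => (u n).1 := by
    rw [Metric.cauchySeq_iff']
    intro ε hε
    obtain ⟨N, hN⟩ := exists_nat_one_div_lt (show 0 < ε ^ 2 / 16 by positivity)
    refine ⟨N, fun n hn => ?_⟩
    have h1 := hpar _ (huK n) _ (huK N)
    have h2 := hu n
    have h3 := hu N
    have h4 : 1 / ((n : ℝ) + 1) ≤ 1 / ((N : ℝ) + 1) := Nat.one_div_le_one_div hn
    rw [dist_eq_norm]
    exact lt_of_pow_lt_pow_left₀ 2 hε.le (by linarith)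
  obtain ⟨p, hp⟩ := cauchySeq_tendsto_of_complete hcau
  have hDu : Tendsto (fun n => D (u n)) atTop (nhds m) :=
    tendsto_of_tendsto_of_tendsto_of_le_of_le tendsto_const_nhds
      (by simpa using hone.const_add m) (fun n => hm _ (huK n)) (fun n => (hu n).le)
  have hc : Tendsto (fun n => (u n).2) atTop (nhds (m - ‖p‖ ^ 2 / 4)) := by
    simpa [hD] using hDu.sub ((hp.norm.pow 2).div_const 4)
  refine ⟨(p, m - ‖p‖ ^ 2 / 4),
    hcl.mem_of_tendsto (hp.prodMk_nhds hc) (Eventually.of_forall huK), fun z hz => ?_⟩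
  simpa [hD] using hm z hz

/-- First-order optimality condition for a minimizer of `(p, c) ↦ ‖p‖² / 4 + c` on a convex set. -/
theorem IsMinOn.inner_add_nonneg {K : Set (X × ℝ)} (hK : Convex ℝ K) {z w : X × ℝ} (hz : z ∈ K)
    (hmin : IsMinOn (fun z : X × ℝ => ‖z.1‖ ^ 2 / 4 + z.2) K z) (hw : w ∈ K) :
    0 ≤ ⟪z.1, w.1 - z.1⟫ / 2 + (w.2 - z.2) := by
  have key : ∀ t : ℝ, 0 < t → t ≤ 1 →
      0 ≤ ⟪z.1, w.1 - z.1⟫ / 2 + (w.2 - z.2) + t * (‖w.1 - z.1‖ ^ 2 / 4) := by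
    intro t ht ht1
    have h := hmin (hK.add_smul_sub_mem hz hw ⟨ht.le, ht1⟩)
    simp only [Set.mem_ofPred_eq, Prod.fst_add, Prod.snd_add, Prod.smul_fst, Prod.smul_snd,
      Prod.fst_sub, Prod.snd_sub, smul_eq_mul, norm_add_sq_real, norm_smul, inner_smul_right,
      mul_pow, Real.norm_eq_abs, sq_abs] at h
    refine nonneg_of_mul_nonneg_right (a := t) ?_ ht
    linarith
  have hlim : Tendsto (fun t : ℝ => ⟪z.1, w.1 - z.1⟫ / 2 + (w.2 - z.2) + t * (‖w.1 - z.1‖ ^ 2 / 4))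
      (nhdsWithin 0 (Set.Ioi 0)) (nhds (⟪z.1, w.1 - z.1⟫ / 2 + (w.2 - z.2))) := by
    refine tendsto_nhdsWithin_of_tendsto_nhds ?_
    exact Continuous.tendsto' (by fun_prop) _ _ (by simp)
  refine ge_of_tendsto hlim ?_
  filter_upwards [Ioc_mem_nhdsGT (zero_lt_one (α := ℝ))] with t ht using key t ht.1 ht.2

/-- On the convex hull of the points `(y, v, ⟪y, v⟫)` over a monotone graph, the last coordinate
dominates the inner product of the first two. -/
theorem inner_le_of_mem_convexHull {G : Set (X × X)}
    (hG : ∀ z ∈ G, ∀ w ∈ G, 0 ≤ ⟪z.1 - w.1, z.2 - w.2⟫) {q : X × X × ℝ}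
    (hq : q ∈ convexHull ℝ ((fun z : X × X => (z.1, z.2, ⟪z.1, z.2⟫)) '' G)) :
    ⟪q.1, q.2.1⟫ ≤ q.2.2 := by
  set S := (fun z : X × X => (z.1, z.2, ⟪z.1, z.2⟫)) '' G
  have hconv : ∀ r : X × X × ℝ,
      Convex ℝ {q : X × X × ℝ | ⟪q.1, r.2.1⟫ + ⟪r.1, q.2.1⟫ ≤ q.2.2 + r.2.2} := by
    intro r q hq q' hq' a b ha hb hab
    simp only [Set.mem_ofPred_eq, Prod.fst_add, Prod.snd_add, Prod.smul_fst, Prod.smul_snd,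
      smul_eq_mul, inner_add_left, inner_add_right, real_inner_smul_left,
      real_inner_smul_right] at hq hq' ⊢
    have hr : r.2.2 = a * r.2.2 + b * r.2.2 := by rw [← add_mul, hab, one_mul]
    have h1 := mul_le_mul_of_nonneg_left hq ha
    have h2 := mul_le_mul_of_nonneg_left hq' hb
    linarith
  have hSS : ∀ r ∈ S, ∀ q ∈ S, ⟪q.1, r.2.1⟫ + ⟪r.1, q.2.1⟫ ≤ q.2.2 + r.2.2 := by
    rintro _ ⟨z, hz, rfl⟩ _ ⟨w, hw, rfl⟩
    have h := hG w hw z hz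
    simp only [inner_sub_left, inner_sub_right] at h ⊢
    linarith
  have hSK : ∀ r ∈ S, ∀ q ∈ convexHull ℝ S, ⟪q.1, r.2.1⟫ + ⟪r.1, q.2.1⟫ ≤ q.2.2 + r.2.2 :=
    fun r hr => convexHull_min (hSS r hr) (hconv r)
  have h := convexHull_min (fun r hr => by
    have := hSK r hr q hq
    rw [Set.mem_ofPred_eq]
    linarith) (hconv q) hq
  rw [Set.mem_ofPred_eq] at h
  linarith

/-- The extension step in Minty's theorem: for a monotone graph `G` there is a point `a` such that
`(a, -a)` is monotonically related to `G`. -/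
theorem exists_forall_inner_sub_add_nonpos [CompleteSpace X] {G : Set (X × X)}
    (hG : ∀ z ∈ G, ∀ w ∈ G, 0 ≤ ⟪z.1 - w.1, z.2 - w.2⟫) :
    ∃ a : X, ∀ z ∈ G, ⟪a - z.1, a + z.2⟫ ≤ 0 := by
  obtain rfl | hne := G.eq_empty_or_nonempty
  · exact ⟨0, by simp⟩
  set H := convexHull ℝ ((fun z : X × X => (z.1, z.2, ⟪z.1, z.2⟫)) '' G)
  let L : X × X × ℝ →ₗ[ℝ] X × ℝ :=
    (LinearMap.fst ℝ X (X × ℝ) - LinearMap.fst ℝ X ℝ ∘ₗ LinearMap.snd ℝ X (X × ℝ)).prod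
      (LinearMap.snd ℝ X ℝ ∘ₗ LinearMap.snd ℝ X (X × ℝ))
  have hL : ∀ q, L q = (q.1 - q.2.1, q.2.2) := fun q => rfl
  have hKconv : Convex ℝ (closure (L '' H)) := ((convex_convexHull ℝ _).linear_image L).closure
  have hKG : ∀ z ∈ G, (z.1 - z.2, ⟪z.1, z.2⟫) ∈ closure (L '' H) := fun z hz =>
    subset_closure ⟨_, subset_convexHull ℝ _ ⟨z, hz, rfl⟩, hL _⟩
  have hnonneg : ∀ z ∈ closure (L '' H), 0 ≤ ‖z.1‖ ^ 2 / 4 + z.2 := by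
    refine closure_minimal (t := {z : X × ℝ | 0 ≤ ‖z.1‖ ^ 2 / 4 + z.2}) ?_
      (isClosed_le (by fun_prop) (by fun_prop))
    rintro _ ⟨q, hq, rfl⟩
    have h1 := inner_le_of_mem_convexHull hG hq
    have h2 := norm_add_sq_real q.1 q.2.1
    have h3 := norm_sub_sq_real q.1 q.2.1
    rw [Set.mem_ofPred_eq, hL]
    nlinarith [sq_nonneg ‖q.1 + q.2.1‖]
  obtain ⟨z₀, hz₀, hmin⟩ := exists_isMinOn_norm_sq_add
    (hne.elim fun z hz => ⟨_, hKG z hz⟩) isClosed_closure hKconv hnonneg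
  refine ⟨(1 / 2 : ℝ) • z₀.1, fun z hz => ?_⟩
  have h1 := hmin.inner_add_nonneg hKconv hz₀ (hKG z hz)
  have h2 := hnonneg z₀ hz₀
  simp only [inner_sub_left, inner_sub_right, inner_add_right, real_inner_smul_left,
    real_inner_smul_right, real_inner_self_eq_norm_sq, norm_smul, mul_pow, Real.norm_eq_abs,
    sq_abs] at h1 ⊢
  rw [real_inner_comm z₀.1 z.1]
  linarith

/-- A point that is `α`-monotonically related to a maximally `α`-monotone graph belongs to it. -/
theorem MaxAlphaMonotone.mem_of_forall {A : X → Set X} {α : ℝ} (hA : MaxAlphaMonotone α A)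
    {a u : X} (h : ∀ ⦃y v⦄, v ∈ A y → α * ‖a - y‖ ^ 2 ≤ ⟪a - y, u - v⟫) : u ∈ A a := by
  refine hA.2 (fun y => A y ∪ {v | y = a ∧ v = u}) ?_ (fun _ => Set.subset_union_left) a
    (Or.inr ⟨rfl, rfl⟩)
  rintro y z v w (hv | ⟨rfl, rfl⟩) (hw | ⟨rfl, rfl⟩)
  · exact hA.1 hv hw
  · rw [← neg_sub, ← neg_sub w v, norm_neg, inner_neg_neg]
    exact h hv
  · exact h hw
  · simp

theorem stmt4 [CompleteSpace X] (A : X → Set X) (α : ℝ) (hA : AlphaMonotone α A)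
    (γ : ℝ) (hγ : 0 < γ) (hpos : 0 < 1 + γ * α) :
    (∀ x : X, ∃ a : X, x - a ∈ γ • A a) ↔ MaxAlphaMonotone α A := by
  constructor
  · refine fun h => ⟨hA, fun B hB hAB x u hu => ?_⟩
    obtain ⟨a, u', hu', hau : γ • u' = x + γ • u - a⟩ := h (x + γ • u)
    have hmono := mul_le_mul_of_nonneg_left (hB hu (hAB a hu')) hγ.le
    have hsub : γ • (u - u') = -(x - a) := by rw [smul_sub, hau]; abel
    rw [← real_inner_smul_right, hsub, inner_neg_right, real_inner_self_eq_norm_sq] at hmono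
    have hsq : ‖x - a‖ ^ 2 = 0 := by nlinarith [sq_nonneg ‖x - a‖]
    obtain rfl : x = a := by simpa [sub_eq_zero] using hsq
    obtain rfl : u = u' := by simpa [hγ.ne', sub_eq_zero] using hsub
    exact hu'
  · intro hmax x
    set β := 1 + γ * α with hβ
    obtain ⟨a, ha⟩ := exists_forall_inner_sub_add_nonpos
      (G := {z | ∃ y, ∃ v ∈ A y, z = (y, β⁻¹ • (γ • (v - α • y) - x))}) (by
        rintro _ ⟨y, v, hv, rfl⟩ _ ⟨z, w, hw, rfl⟩
        have h := hA hv hw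
        have hdiff : β⁻¹ • (γ • (v - α • y) - x) - β⁻¹ • (γ • (w - α • z) - x)
            = β⁻¹ • γ • ((v - w) - α • (y - z)) := by module
        dsimp only
        rw [hdiff, real_inner_smul_right, real_inner_smul_right, inner_sub_right,
          real_inner_smul_right, real_inner_self_eq_norm_sq]
        exact mul_nonneg (inv_nonneg.2 hpos.le) (mul_nonneg hγ.le (sub_nonneg.2 h)))
    refine ⟨a, γ⁻¹ • (x - a), hmax.mem_of_forall fun y v hv => ?_, smul_inv_smul₀ hγ.ne' _⟩
    have h : ⟪a - y, a + β⁻¹ • (γ • (v - α • y) - x)⟫ ≤ 0 := ha _ ⟨y, v, hv, rfl⟩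
    have hscale : a + β⁻¹ • (γ • (v - α • y) - x)
        = (β⁻¹ * γ) • (α • (a - y) - (γ⁻¹ • (x - a) - v)) := by
      match_scalars <;> field_simp
      rw [hβ]
      ring
    rw [hscale, real_inner_smul_right, inner_sub_right, real_inner_smul_right,
      real_inner_self_eq_norm_sq] at h
    exact sub_nonpos.1 (nonpos_of_mul_nonpos_right h (mul_pos (inv_pos.2 hpos) hγ))
end

section
/- Let X be a real Hilbert space, let A: X ⇒ X be a set-valued operator and let α ≥ 0. Then A is maximally α-monotone if and only if A is α-monotone and maximally monotone (i.e., maximally 0-monotone). -/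
open Pointwise RealInnerProductSpace Filter

variable {X : Type*} [NormedAddCommGroup X] [InnerProductSpace ℝ X]

/-- Maximality in terms of points: every pair that is `α`-monotonically related to the graph
belongs to the graph. -/
lemma maxAlphaMonotone_iff {α : ℝ} {A : X → Set X} :
    MaxAlphaMonotone α A ↔ AlphaMonotone α A ∧
      ∀ x u, (∀ y, ∀ v ∈ A y, α * ‖x - y‖ ^ 2 ≤ ⟪x - y, u - v⟫) → u ∈ A x := by
  refine ⟨fun ⟨hA, hmax⟩ => ⟨hA, fun x u hxu => ?_⟩, fun ⟨hA, hmax⟩ => ⟨hA, ?_⟩⟩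
  · refine hmax (fun z => {w | w ∈ A z ∨ z = x ∧ w = u}) ?_ (fun z w hw => Or.inl hw) x
      (Or.inr ⟨rfl, rfl⟩)
    rintro y z v w (hv | ⟨rfl, rfl⟩) (hw | ⟨rfl, rfl⟩)
    · exact hA hv hw
    · rw [norm_sub_rev, ← neg_sub z y, ← neg_sub w v, inner_neg_neg]
      exact hxu _ _ hv
    · exact hxu _ _ hw
    · simp
  · intro B hB hAB x u hu
    exact hmax x u fun y v hv => hB hu (hAB y hv)

/-- A function `(z, r) ↦ r + ‖z‖² / 2` that is bounded below on a nonempty closed convex set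
attains its minimum there. -/
lemma exists_forall_add_sq_norm_le {E : Type*} [NormedAddCommGroup E] [InnerProductSpace ℝ E]
    [CompleteSpace E] {C : Set (E × ℝ)} (hne : C.Nonempty) (hcl : IsClosed C) (hco : Convex ℝ C)
    {m : ℝ} (hm : ∀ p ∈ C, m ≤ p.2 + ‖p.1‖ ^ 2 / 2) :
    ∃ p ∈ C, ∀ q ∈ C, p.2 + ‖p.1‖ ^ 2 / 2 ≤ q.2 + ‖q.1‖ ^ 2 / 2 := by
  set g : E × ℝ → ℝ := fun p => p.2 + ‖p.1‖ ^ 2 / 2 with hg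
  have hbdd : BddBelow (g '' C) := ⟨m, by rintro _ ⟨p, hp, rfl⟩; exact hm p hp⟩
  set I := sInf (g '' C) with hI
  have hle : ∀ p ∈ C, I ≤ g p := fun p hp => csInf_le hbdd ⟨p, hp, rfl⟩
  have hseq : ∀ n : ℕ, ∃ p ∈ C, g p < I + 1 / ((n : ℝ) + 1) := fun n => by
    obtain ⟨_, ⟨p, hp, rfl⟩, h⟩ := exists_lt_of_csInf_lt (hne.image g)
      (lt_add_of_pos_right I (Nat.one_div_pos_of_nat (α := ℝ) (n := n)))
    exact ⟨p, hp, h⟩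
  choose p hpC hp using hseq
  have hmid : ∀ k l, ‖(p k).1 - (p l).1‖ ^ 2 ≤
      4 * (1 / ((k : ℝ) + 1) + 1 / ((l : ℝ) + 1)) := fun k l => by
    have h := hle _ (hco (hpC k) (hpC l) (a := 1 / 2) (b := 1 / 2) (by norm_num) (by norm_num)
      (by norm_num))
    have hk := hp k
    have hl := hp l
    simp only [hg, Prod.fst_add, Prod.snd_add, Prod.smul_fst, Prod.smul_snd, ← smul_add,
      norm_smul, smul_eq_mul] at h hk hl
    have hpar := parallelogram_law_with_norm ℝ (p k).1 (p l).1
    norm_num [mul_pow] at h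
    nlinarith
  have htend : Tendsto (fun n : ℕ => 1 / ((n : ℝ) + 1)) atTop (nhds 0) :=
    tendsto_one_div_add_atTop_nhds_zero_nat
  have hcau : CauchySeq fun n => (p n).1 := by
    refine cauchySeq_of_le_tendsto_0 (fun n : ℕ => √(8 * (1 / ((n : ℝ) + 1)))) ?_ ?_
    · intro k l N hk hl
      rw [dist_eq_norm]
      refine Real.le_sqrt_of_sq_le ((hmid k l).trans ?_)
      have := Nat.one_div_le_one_div (α := ℝ) hk
      have := Nat.one_div_le_one_div (α := ℝ) hl
      linarith
    · simpa using (htend.const_mul 8).sqrt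
  obtain ⟨z, hz⟩ := cauchySeq_tendsto_of_complete hcau
  have hgt : Tendsto (fun n => g (p n)) atTop (nhds I) :=
    tendsto_of_tendsto_of_tendsto_of_le_of_le tendsto_const_nhds
      (by simpa using htend.const_add I) (fun n => hle _ (hpC n)) (fun n => (hp n).le)
  have hr : Tendsto (fun n => (p n).2) atTop (nhds (I - ‖z‖ ^ 2 / 2)) := by
    refine (hgt.sub ((hz.norm.pow 2).div_const 2)).congr fun n => ?_
    simp [hg]
  refine ⟨(z, I - ‖z‖ ^ 2 / 2), hcl.mem_of_tendsto (hz.prodMk_nhds hr)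
    (Eventually.of_forall hpC), fun q hq => ?_⟩
  simpa using hle q hq

/-- First-order optimality condition for a minimizer of `(z, r) ↦ r + ‖z‖² / 2`. -/
lemma snd_add_inner_nonneg_of_forall_le {E : Type*} [NormedAddCommGroup E]
    [InnerProductSpace ℝ E] {C : Set (E × ℝ)} (hco : Convex ℝ C) {p : E × ℝ} (hp : p ∈ C)
    (hmin : ∀ q ∈ C, p.2 + ‖p.1‖ ^ 2 / 2 ≤ q.2 + ‖q.1‖ ^ 2 / 2) {q : E × ℝ} (hq : q ∈ C) :
    0 ≤ q.2 - p.2 + ⟪p.1, q.1 - p.1⟫ := by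
  have key : ∀ t : ℝ, 0 < t → t ≤ 1 →
      0 ≤ q.2 - p.2 + ⟪p.1, q.1 - p.1⟫ + t * (‖q.1 - p.1‖ ^ 2 / 2) := fun t ht ht1 => by
    have h := hmin _ (hco.add_smul_sub_mem hp hq ⟨ht.le, ht1⟩)
    simp only [Prod.fst_add, Prod.snd_add, Prod.smul_fst, Prod.smul_snd, Prod.fst_sub,
      Prod.snd_sub, norm_add_sq_real, inner_smul_right, norm_smul, smul_eq_mul, mul_pow,
      Real.norm_eq_abs, sq_abs] at h
    refine nonneg_of_mul_nonneg_right (b := _) (a := t) ?_ ht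
    linarith
  have hlim : Tendsto (fun t : ℝ => q.2 - p.2 + ⟪p.1, q.1 - p.1⟫ + t * (‖q.1 - p.1‖ ^ 2 / 2))
      (nhdsWithin 0 (Set.Ioi 0)) (nhds (q.2 - p.2 + ⟪p.1, q.1 - p.1⟫)) := by
    refine Tendsto.mono_left ?_ nhdsWithin_le_nhds
    have : Continuous fun t : ℝ =>
      q.2 - p.2 + ⟪p.1, q.1 - p.1⟫ + t * (‖q.1 - p.1‖ ^ 2 / 2) := by fun_prop
    simpa using this.tendsto 0
  refine ge_of_tendsto hlim ?_
  filter_upwards [Ioc_mem_nhdsGT (zero_lt_one' ℝ)] with t ht using key t ht.1 ht.2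

/-- The epigraph of the Fitzpatrick function of `T`. -/
def fitzpatrickEpigraph (T : X → Set X) : Set (WithLp 2 (X × X) × ℝ) :=
  {p | ∀ b, ∀ s ∈ T b, ⟪p.1.fst, s⟫ + ⟪b, p.1.snd⟫ - ⟪b, s⟫ ≤ p.2}

lemma isClosed_fitzpatrickEpigraph (T : X → Set X) : IsClosed (fitzpatrickEpigraph T) := by
  simp only [fitzpatrickEpigraph, Set.ofPred_forall]
  refine isClosed_iInter fun b => isClosed_iInter fun s => isClosed_iInter fun _ =>
    isClosed_le ?_ continuous_snd
  have h1 : Continuous fun p : WithLp 2 (X × X) × ℝ => p.1.fst :=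
    (WithLp.continuous_fst 2 X X).comp continuous_fst
  have h2 : Continuous fun p : WithLp 2 (X × X) × ℝ => p.1.snd :=
    (WithLp.continuous_snd 2 X X).comp continuous_fst
  fun_prop

lemma convex_fitzpatrickEpigraph (T : X → Set X) : Convex ℝ (fitzpatrickEpigraph T) := by
  intro p hp q hq a c ha hc hac b s hs
  have h1 := mul_le_mul_of_nonneg_left (hp b s hs) ha
  have h2 := mul_le_mul_of_nonneg_left (hq b s hs) hc
  simp only [Prod.fst_add, Prod.snd_add, Prod.smul_fst, Prod.smul_snd, WithLp.add_fst,
    WithLp.add_snd, WithLp.smul_fst, WithLp.smul_snd, inner_add_left, inner_add_right,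
    real_inner_smul_left, real_inner_smul_right, smul_eq_mul]
  have : ⟪b, s⟫ = a * ⟪b, s⟫ + c * ⟪b, s⟫ := by rw [← add_mul, hac, one_mul]
  linarith

lemma mem_fitzpatrickEpigraph_of_mem {T : X → Set X} (hT : AlphaMonotone 0 T) {b s : X}
    (hs : s ∈ T b) : (WithLp.toLp 2 (b, s), ⟪b, s⟫) ∈ fitzpatrickEpigraph T := by
  intro c t ht
  have h := hT hs ht
  simp only [inner_sub_left, inner_sub_right] at h
  simp only [WithLp.toLp_fst, WithLp.toLp_snd]
  linarith

lemma inner_le_of_mem_fitzpatrickEpigraph {T : X → Set X} (hT : MaxAlphaMonotone 0 T)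
    {p : WithLp 2 (X × X) × ℝ} (hp : p ∈ fitzpatrickEpigraph T) :
    ⟪p.1.fst, p.1.snd⟫ ≤ p.2 := by
  by_contra! h
  have hmem : p.1.snd ∈ T p.1.fst := (maxAlphaMonotone_iff.1 hT).2 _ _ fun b s hs => by
    have := hp b s hs
    simp only [inner_sub_left, inner_sub_right]
    linarith
  have := hp _ _ hmem
  linarith

/-- Minty's theorem: if `T` is maximally monotone, then `0` lies in the range of `T + Id`. -/
theorem MaxAlphaMonotone.exists_neg_mem [CompleteSpace X] {T : X → Set X}
    (hT : MaxAlphaMonotone 0 T) : ∃ y, -y ∈ T y := by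
  obtain ⟨b, s, hs⟩ : ∃ b s, s ∈ T b := by
    by_contra! h
    exact h 0 0 ((maxAlphaMonotone_iff.1 hT).2 0 0 fun y v hv => (h y v hv).elim)
  have hco := convex_fitzpatrickEpigraph T
  obtain ⟨p, hpC, hp⟩ := exists_forall_add_sq_norm_le (m := 0)
    ⟨_, mem_fitzpatrickEpigraph_of_mem hT.1 hs⟩ (isClosed_fitzpatrickEpigraph T) hco
    fun p hp => by
      have h := inner_le_of_mem_fitzpatrickEpigraph hT hp
      have := norm_add_sq_real p.1.fst p.1.snd
      rw [WithLp.prod_norm_sq_eq_of_L2]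
      nlinarith [sq_nonneg ‖p.1.fst + p.1.snd‖]
  have hle := inner_le_of_mem_fitzpatrickEpigraph hT hpC
  have key : ∀ b, ∀ s ∈ T b,
      ‖p.1.fst + p.1.snd‖ ^ 2 ≤ ⟪-p.1.snd - b, -p.1.fst - s⟫ := fun b s hs => by
    have h := snd_add_inner_nonneg_of_forall_le hco hpC hp
      (mem_fitzpatrickEpigraph_of_mem hT.1 hs)
    simp only [inner_sub_right, real_inner_self_eq_norm_sq, WithLp.prod_inner_apply,
      WithLp.ofLp_fst, WithLp.ofLp_snd] at h
    simp only [inner_sub_left, inner_sub_right, inner_neg_left, inner_neg_right,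
      norm_add_sq_real]
    rw [real_inner_comm p.1.fst p.1.snd, real_inner_comm p.1.fst b]
    linarith
  have hmem : -p.1.fst ∈ T (-p.1.snd) := (maxAlphaMonotone_iff.1 hT).2 _ _ fun b s hs => by
    simpa using (sq_nonneg _).trans (key b s hs)
  have h0 : p.1.fst + p.1.snd = 0 := by
    have := key _ _ hmem
    rw [sub_self, inner_zero_left] at this
    exact norm_eq_zero.1 (pow_eq_zero_iff two_ne_zero |>.1 (this.antisymm (sq_nonneg _)))
  rw [neg_eq_of_add_eq_zero_left h0] at hmem
  exact ⟨_, hmem⟩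

/-- Subtracting `α • Id`, translating and rescaling turns maximal `α`-monotonicity into maximal
monotonicity. -/
lemma MaxAlphaMonotone.shift {α : ℝ} {A : X → Set X} (hA : MaxAlphaMonotone α A) {c : ℝ}
    (hc : 0 < c) (w : X) : MaxAlphaMonotone 0 fun y => {s | c • s + α • y + w ∈ A y} := by
  have hinner : ∀ x y s t : X, ⟪x - y, (c • s + α • x + w) - (c • t + α • y + w)⟫ =
      c * ⟪x - y, s - t⟫ + α * ‖x - y‖ ^ 2 := fun x y s t => by
    rw [← real_inner_self_eq_norm_sq, ← real_inner_smul_right, ← real_inner_smul_right,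
      ← inner_add_right]
    congr 1
    module
  rw [maxAlphaMonotone_iff] at hA ⊢
  refine ⟨fun x y s t hs ht => ?_, fun x s h => hA.2 _ _ fun y v hv => ?_⟩
  · have := hA.1 hs ht
    rw [hinner] at this
    rw [zero_mul]
    exact nonneg_of_mul_nonneg_right (by linarith) hc
  · have hv' : v = c • (c⁻¹ • (v - α • y - w)) + α • y + w := by
      rw [smul_inv_smul₀ hc.ne']
      module
    rw [hv'] at hv ⊢
    have := h y _ hv
    rw [zero_mul] at this
    rw [hinner]
    nlinarith [mul_nonneg hc.le this]

theorem stmt5 [CompleteSpace X] (A : X → Set X) (α : ℝ) (hα : 0 ≤ α) :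
    MaxAlphaMonotone α A ↔ AlphaMonotone α A ∧ MaxAlphaMonotone 0 A := by
  refine ⟨fun hA => ⟨hA.1, maxAlphaMonotone_iff.2 ⟨fun x y u v hu hv => ?_, fun x u h => ?_⟩⟩,
    fun ⟨hA, h0⟩ => ⟨hA, fun B hB => h0.2 B fun x y u v hu hv => ?_⟩⟩
  · rw [zero_mul]
    exact le_trans (by positivity) (hA.1 hu hv)
  · obtain ⟨y, hy⟩ := (hA.shift (c := 1 + α) (by linarith) (u + x)).exists_neg_mem
    have hy' : u + (x - y) ∈ A y := by
      rw [Set.mem_ofPred_eq] at hy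
      convert hy using 1
      module
    have hxy := h y _ hy'
    rw [sub_add_cancel_left, inner_neg_right, real_inner_self_eq_norm_sq, zero_mul] at hxy
    have : x - y = 0 := norm_eq_zero.1 (pow_eq_zero_iff two_ne_zero |>.1
      (le_antisymm (by linarith) (sq_nonneg _)))
    rw [this, add_zero] at hy'
    rwa [sub_eq_zero.1 this]
  · rw [zero_mul]
    exact le_trans (by positivity) (hB hu hv)
end

section
/- Let X be a real Hilbert space, let A: X → X be Lipschitz continuous with constant ℓ ≥ 0, and let γ > 0. If x = a + γ·A a and y = b + γ·A b, then: (i) ‖a − b‖ ≥ ‖x − y‖/(1 + γℓ); (ii) ⟨x − y, a − b⟩ ≥ (1/2)‖x − y‖² + (1/2)(1 − γ²ℓ²)‖a − b‖²; and (iii) if γℓ ≤ 1, then ⟨x − y, a − b⟩ ≥ ‖x − y‖²/(1 + γℓ). -/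
open Pointwise RealInnerProductSpace Filter

variable {X : Type*} [NormedAddCommGroup X] [InnerProductSpace ℝ X]

/-- If `‖p - q‖ ≤ k‖q‖`, then `⟪p, q⟫ ≥ ½‖p‖² + ½(1 - k²)‖q‖²`. -/
theorem half_norm_sq_add_le_inner_of_norm_sub_le {E : Type*} [NormedAddCommGroup E]
    [InnerProductSpace ℝ E] {p q : E} {k : ℝ} (h : ‖p - q‖ ≤ k * ‖q‖) :
    (1 / 2) * ‖p‖ ^ 2 + (1 / 2) * (1 - k ^ 2) * ‖q‖ ^ 2 ≤ inner ℝ p q := by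
  have hsq : ‖p - q‖ ^ 2 ≤ (k * ‖q‖) ^ 2 := pow_le_pow_left₀ (norm_nonneg _) h 2
  rw [norm_sub_sq_real] at hsq
  linarith

theorem stmt7 (A : X → X) (ℓ : ℝ) (hℓ : 0 ≤ ℓ)
    (hlip : ∀ x y : X, ‖A x - A y‖ ≤ ℓ * ‖x - y‖)
    (γ : ℝ) (hγ : 0 < γ) (x a y b : X)
    (hx : x = a + γ • A a) (hy : y = b + γ • A b) :
    ‖x - y‖ / (1 + γ * ℓ) ≤ ‖a - b‖ ∧
      (1 / 2) * ‖x - y‖ ^ 2 + (1 / 2) * (1 - γ ^ 2 * ℓ ^ 2) * ‖a - b‖ ^ 2 ≤ ⟪x - y, a - b⟫ ∧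
      (γ * ℓ ≤ 1 → ‖x - y‖ ^ 2 / (1 + γ * ℓ) ≤ ⟪x - y, a - b⟫) := by
  have hk : 0 < 1 + γ * ℓ := by positivity
  have hsub : x - y - (a - b) = γ • (A a - A b) := by
    rw [hx, hy, smul_sub]
    abel
  have hle : ‖x - y - (a - b)‖ ≤ γ * ℓ * ‖a - b‖ := by
    rw [hsub, norm_smul, Real.norm_of_nonneg hγ.le, mul_assoc]
    exact mul_le_mul_of_nonneg_left (hlip a b) hγ.le
  have hnorm : ‖x - y‖ / (1 + γ * ℓ) ≤ ‖a - b‖ := by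
    rw [div_le_iff₀ hk]
    linarith [norm_sub_norm_le (x - y) (a - b)]
  have hinner := half_norm_sq_add_le_inner_of_norm_sub_le hle
  rw [mul_pow] at hinner
  refine ⟨hnorm, hinner, fun h => le_trans ?_ hinner⟩
  have hcoef : 0 ≤ (1 / 2) * (1 - γ ^ 2 * ℓ ^ 2) := by
    nlinarith [mul_nonneg (sub_nonneg.2 h) hk.le]
  calc ‖x - y‖ ^ 2 / (1 + γ * ℓ)
      = (1 / 2) * ‖x - y‖ ^ 2 +
          (1 / 2) * (1 - γ ^ 2 * ℓ ^ 2) * (‖x - y‖ / (1 + γ * ℓ)) ^ 2 := by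
        field_simp
        ring
    _ ≤ (1 / 2) * ‖x - y‖ ^ 2 + (1 / 2) * (1 - γ ^ 2 * ℓ ^ 2) * ‖a - b‖ ^ 2 := by
        gcongr
end

section
/- Let X be a real Hilbert space, let A: X → X be α-monotone and Lipschitz continuous with constant ℓ, where |α| ≤ ℓ, and let γ > 0 with 1 + γα > 0. Let J: X → X satisfy J x + γ·A(J x) = x for all x ∈ X (so J is the resolvent of γA). Then for all x, y ∈ X, ⟨x − y, J x − J y⟩ ≥ (1 + γα)·α_J·‖x − y‖², where α_J = 1/(1 + 2γα + γ²ℓ²) if γℓ ≥ 1 and α_J = 1/((1 + γα)(1 + γℓ)) if γℓ ≤ 1. Moreover, if additionally ⟨x − y, Ax − Ay⟩ = α‖x − y‖² for all x, y ∈ X, then the inequality holds with α_J = 1/(1 + 2γα + γ²ℓ²) regardless of the size of γℓ. -/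
open Pointwise RealInnerProductSpace Filter

variable {X : Type*} [NormedAddCommGroup X] [InnerProductSpace ℝ X]

/-- If `p` and `q` satisfy `(L² - 1)(⟪p, q⟫ - a‖p‖²) ≥ 0` and `‖q‖ ≤ L‖p‖`, then `p + q` and `p`
satisfy the resolvent monotonicity bound with constant `(1 + a) / (1 + 2a + L²)`. -/
lemma resolvent_bound_of_mul_nonneg {a L : ℝ} (haL : |a| ≤ L) (ha : 0 < 1 + a) {p q : X}
    (hq : ‖q‖ ^ 2 ≤ L ^ 2 * ‖p‖ ^ 2) (h : 0 ≤ (L ^ 2 - 1) * (⟪p, q⟫ - a * ‖p‖ ^ 2)) :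
    (1 + a) * (1 / (1 + 2 * a + L ^ 2)) * ‖p + q‖ ^ 2 ≤ ⟪p + q, p⟫ := by
  have haL2 : a ^ 2 ≤ L ^ 2 := sq_le_sq.mpr (haL.trans (le_abs_self L))
  have hden : 0 < 1 + 2 * a + L ^ 2 := by nlinarith
  rw [mul_one_div, div_mul_eq_mul_div, div_le_iff₀ hden, norm_add_sq_real, inner_add_left,
    real_inner_self_eq_norm_sq, real_inner_comm p q]
  nlinarith [mul_le_mul_of_nonneg_left hq ha.le]

/-- If `‖q‖ ≤ L‖p‖` with `0 ≤ L ≤ 1`, then `p + q` and `p` satisfy the resolvent monotonicity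
bound with constant `1 / (1 + L)`. -/
lemma resolvent_bound_of_le_one {L : ℝ} (hL0 : 0 ≤ L) (hL1 : L ≤ 1) {p q : X}
    (hq : ‖q‖ ≤ L * ‖p‖) : 1 / (1 + L) * ‖p + q‖ ^ 2 ≤ ⟪p + q, p⟫ := by
  have hq2 : ‖q‖ ^ 2 ≤ (L * ‖p‖) ^ 2 := pow_le_pow_left₀ (norm_nonneg q) hq 2
  have hpq : ⟪p, q⟫ ≤ L * ‖p‖ ^ 2 :=
    (real_inner_le_norm p q).trans (by nlinarith [norm_nonneg p])
  rw [div_mul_eq_mul_div, div_le_iff₀ (by linarith), norm_add_sq_real, inner_add_left,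
    real_inner_self_eq_norm_sq, real_inner_comm p q]
  nlinarith [mul_nonneg (sub_nonneg.mpr hL1) (sub_nonneg.mpr hpq)]

theorem stmt8 (A : X → X) (α ℓ : ℝ) (hαℓ : |α| ≤ ℓ)
    (hmono : ∀ x y : X, α * ‖x - y‖ ^ 2 ≤ ⟪x - y, A x - A y⟫)
    (hlip : ∀ x y : X, ‖A x - A y‖ ≤ ℓ * ‖x - y‖)
    (γ : ℝ) (hγ : 0 < γ) (hpos : 0 < 1 + γ * α)
    (J : X → X) (hJ : ∀ x, J x + γ • A (J x) = x) :
    let αJ : ℝ :=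
      if 1 ≤ γ * ℓ then 1 / (1 + 2 * γ * α + γ ^ 2 * ℓ ^ 2)
      else 1 / ((1 + γ * α) * (1 + γ * ℓ))
    (∀ x y : X, (1 + γ * α) * αJ * ‖x - y‖ ^ 2 ≤ ⟪x - y, J x - J y⟫) ∧
      ((∀ x y : X, ⟪x - y, A x - A y⟫ = α * ‖x - y‖ ^ 2) →
        ∀ x y : X,
          (1 + γ * α) * (1 / (1 + 2 * γ * α + γ ^ 2 * ℓ ^ 2)) * ‖x - y‖ ^ 2 ≤
            ⟪x - y, J x - J y⟫) := by
  intro αJ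
  have hℓ : 0 ≤ ℓ := (abs_nonneg α).trans hαℓ
  have hγℓ : 0 ≤ γ * ℓ := mul_nonneg hγ.le hℓ
  have habs : |γ * α| ≤ γ * ℓ := by
    rw [abs_mul, abs_of_pos hγ]
    exact mul_le_mul_of_nonneg_left hαℓ hγ.le
  have hsub (x y : X) : x - y = (J x - J y) + γ • (A (J x) - A (J y)) := by
    nth_rewrite 1 [← hJ x, ← hJ y]
    rw [smul_sub]
    abel
  have hnorm (u v : X) : ‖γ • (A u - A v)‖ ≤ γ * ℓ * ‖u - v‖ := by
    rw [norm_smul, Real.norm_of_nonneg hγ.le, mul_assoc]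
    exact mul_le_mul_of_nonneg_left (hlip u v) hγ.le
  have hnorm_sq (u v : X) : ‖γ • (A u - A v)‖ ^ 2 ≤ (γ * ℓ) ^ 2 * ‖u - v‖ ^ 2 := by
    rw [← mul_pow]
    exact pow_le_pow_left₀ (norm_nonneg _) (hnorm u v) 2
  have hden : 1 + 2 * γ * α + γ ^ 2 * ℓ ^ 2 = 1 + 2 * (γ * α) + (γ * ℓ) ^ 2 := by ring
  refine ⟨fun x y => ?_, fun heq x y => ?_⟩
  · by_cases hL : 1 ≤ γ * ℓ
    · simp only [αJ, if_pos hL]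
      rw [hden, hsub x y]
      refine resolvent_bound_of_mul_nonneg habs hpos (hnorm_sq _ _) (mul_nonneg ?_ ?_)
      · nlinarith
      · rw [real_inner_smul_right, mul_assoc, ← mul_sub]
        exact mul_nonneg hγ.le (sub_nonneg.mpr (hmono _ _))
    · have hcancel : (1 + γ * α) * (1 / ((1 + γ * α) * (1 + γ * ℓ))) = 1 / (1 + γ * ℓ) := by
        field_simp
      simp only [αJ, if_neg hL]
      rw [hcancel, hsub x y]
      exact resolvent_bound_of_le_one hγℓ (not_le.mp hL).le (hnorm _ _)
  · rw [hden, hsub x y]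
    refine resolvent_bound_of_mul_nonneg habs hpos (hnorm_sq _ _) (le_of_eq ?_)
    rw [real_inner_smul_right, heq]
    ring
end

section
/- Let X be a real Hilbert space, let A: X ⇒ X be α-monotone, let γ > 0, and let J: X → X satisfy x − J x ∈ γ·A(J x) for all x ∈ X (so J is a single-valued selection of the resolvent J_{γA}). Let ν, λ ∈ ℝ with νλ ≤ 0 and define Q := ν·Id + λ·J. Then for all x, y ∈ X, ‖Qx − Qy‖² ≤ ν²‖x − y‖² + λ(2ν(1 + γα) + λ)‖Jx − Jy‖². -/
open Pointwise RealInnerProductSpace Filter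

variable {X : Type*} [NormedAddCommGroup X] [InnerProductSpace ℝ X]

/-- A selection of the resolvent of `γA` is `(1 + γα)`-cocoercive. -/
theorem AlphaMonotone.resolvent_cocoercive {A : X → Set X} {α : ℝ} (hA : AlphaMonotone α A)
    {γ : ℝ} (hγ : 0 ≤ γ) {J : X → X} (hJ : ∀ x, x - J x ∈ γ • A (J x)) (x y : X) :
    (1 + γ * α) * ‖J x - J y‖ ^ 2 ≤ ⟪x - y, J x - J y⟫ := by
  obtain ⟨u, hu, hxu⟩ := Set.mem_smul_set.mp (hJ x)
  obtain ⟨v, hv, hyv⟩ := Set.mem_smul_set.mp (hJ y)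
  have hd : x - y = (J x - J y) + γ • (u - v) := by
    rw [smul_sub, hxu, hyv]
    abel
  rw [hd, inner_add_left, real_inner_self_eq_norm_sq, real_inner_smul_left, real_inner_comm]
  linarith [mul_le_mul_of_nonneg_left (hA hu hv) hγ]

theorem stmt9 (A : X → Set X) (α : ℝ) (hA : AlphaMonotone α A)
    (γ : ℝ) (hγ : 0 < γ)
    (J : X → X) (hJ : ∀ x, x - J x ∈ γ • A (J x))
    (ν lam : ℝ) (h : ν * lam ≤ 0) :
    ∀ x y : X,
      ‖(ν • x + lam • J x) - (ν • y + lam • J y)‖ ^ 2 ≤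
        ν ^ 2 * ‖x - y‖ ^ 2 + lam * (2 * ν * (1 + γ * α) + lam) * ‖J x - J y‖ ^ 2 := by
  intro x y
  have hd : (ν • x + lam • J x) - (ν • y + lam • J y) = ν • (x - y) + lam • (J x - J y) := by
    module
  rw [hd, norm_add_sq_real, real_inner_smul_left, real_inner_smul_right, norm_smul, norm_smul,
    mul_pow, mul_pow, Real.norm_eq_abs, Real.norm_eq_abs, sq_abs, sq_abs]
  linarith [mul_le_mul_of_nonpos_left (hA.resolvent_cocoercive hγ.le hJ x y) h]
end

section
/- Let X be a real Hilbert space, let A: X → X be α-monotone and Lipschitz continuous with constant ℓ, where |α| ≤ ℓ, let γ > 0 with 1 + γα > 0, and let J: X → X satisfy J x + γ·A(J x) = x for all x ∈ X. Let ν, λ ∈ ℝ with λ(2ν(1 + γα) + λ) ≤ 0 and define Q := ν·Id + λ·J. Then Q is Lipschitz continuous with constant ρ := √(ν² + λ(2ν(1+γα)+λ)·α_J), where α_J = 1/(1 + 2γα + γ²ℓ²) if γℓ ≥ 1 and α_J = 1/((1+γα)(1+γℓ)) if γℓ ≤ 1. If additionally λ(ν + λ/(1 − γ²ℓ²)) ≥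 0 whenever γℓ < 1, then Q is Lipschitz continuous with the improved constant ρ̄ := √(ν² + λ(2ν(1+γα)+λ)/(1 + 2γα + γ²ℓ²)), and ρ̄ ≤ ρ. -/
open Pointwise RealInnerProductSpace Filter

variable {X : Type*} [NormedAddCommGroup X] [InnerProductSpace ℝ X]

/-- A quadratic estimate on the data of a resolvent with displacement `p + γ • a` gives the
corresponding Lipschitz estimate, even when the argument of the square root is negative. -/
theorem norm_smul_add_smul_le_sqrt_mul_norm (p a : X) (γ ν lam t : ℝ)
    (ht : 2 * ν * lam * (‖p‖ ^ 2 + γ * ⟪p, a⟫) + lam ^ 2 * ‖p‖ ^ 2 ≤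
      t * (‖p‖ ^ 2 + 2 * γ * ⟪p, a⟫ + γ ^ 2 * ‖a‖ ^ 2)) :
    ‖ν • (p + γ • a) + lam • p‖ ≤ √(ν ^ 2 + t) * ‖p + γ • a‖ := by
  have hd : ‖p + γ • a‖ ^ 2 = ‖p‖ ^ 2 + 2 * γ * ⟪p, a⟫ + γ ^ 2 * ‖a‖ ^ 2 := by
    rw [norm_add_sq_real, real_inner_smul_right, norm_smul, mul_pow, Real.norm_eq_abs, sq_abs]
    ring
  have hi : ⟪p + γ • a, p⟫ = ‖p‖ ^ 2 + γ * ⟪p, a⟫ := by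
    rw [inner_add_left, real_inner_smul_left, real_inner_self_eq_norm_sq, real_inner_comm]
  have hq : ‖ν • (p + γ • a) + lam • p‖ ^ 2 ≤ (ν ^ 2 + t) * ‖p + γ • a‖ ^ 2 := by
    rw [norm_add_sq_real, real_inner_smul_left, real_inner_smul_right, hi, norm_smul, norm_smul,
      mul_pow, mul_pow, Real.norm_eq_abs, Real.norm_eq_abs, sq_abs, sq_abs, add_mul, hd]
    linarith
  calc ‖ν • (p + γ • a) + lam • p‖ ≤ √((ν ^ 2 + t) * ‖p + γ • a‖ ^ 2) := Real.le_sqrt_of_sq_le hq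
    _ = √(ν ^ 2 + t) * ‖p + γ • a‖ := by
      rw [Real.sqrt_mul' _ (sq_nonneg _), Real.sqrt_sq (norm_nonneg _)]

theorem stmt10 (A : X → X) (α ℓ : ℝ) (hαℓ : |α| ≤ ℓ)
    (hmono : ∀ x y : X, α * ‖x - y‖ ^ 2 ≤ ⟪x - y, A x - A y⟫)
    (hlip : ∀ x y : X, ‖A x - A y‖ ≤ ℓ * ‖x - y‖)
    (γ : ℝ) (hγ : 0 < γ) (hpos : 0 < 1 + γ * α)
    (J : X → X) (hJ : ∀ x, J x + γ • A (J x) = x)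
    (ν lam : ℝ) (h : lam * (2 * ν * (1 + γ * α) + lam) ≤ 0) :
    let αJ : ℝ :=
      if 1 ≤ γ * ℓ then 1 / (1 + 2 * γ * α + γ ^ 2 * ℓ ^ 2)
      else 1 / ((1 + γ * α) * (1 + γ * ℓ))
    let ρ : ℝ := Real.sqrt (ν ^ 2 + lam * (2 * ν * (1 + γ * α) + lam) * αJ)
    let ρ' : ℝ :=
      Real.sqrt (ν ^ 2 + lam * (2 * ν * (1 + γ * α) + lam) / (1 + 2 * γ * α + γ ^ 2 * ℓ ^ 2))
    (∀ x y : X, ‖(ν • x + lam • J x) - (ν • y + lam • J y)‖ ≤ ρ * ‖x - y‖) ∧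
      ((γ * ℓ < 1 → 0 ≤ lam * (ν + lam / (1 - γ ^ 2 * ℓ ^ 2))) →
        (∀ x y : X, ‖(ν • x + lam • J x) - (ν • y + lam • J y)‖ ≤ ρ' * ‖x - y‖) ∧ ρ' ≤ ρ) := by
  intro αJ ρ ρ'
  have hα : α ≤ ℓ := (le_abs_self α).trans hαℓ
  have hℓ : 0 ≤ ℓ := (abs_nonneg α).trans hαℓ
  have hγℓ : 0 ≤ γ * ℓ := by positivity
  have hE : 0 < 1 + 2 * γ * α + γ ^ 2 * ℓ ^ 2 := by
    have : α ^ 2 ≤ ℓ ^ 2 := sq_le_sq.2 (by rwa [abs_of_nonneg hℓ])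
    nlinarith [mul_le_mul_of_nonneg_left this (sq_nonneg γ), mul_pos hpos hpos]
  have hνlam : 2 * ν * lam ≤ 0 := by
    by_contra! hc
    nlinarith [mul_pos hc hpos, sq_nonneg lam]
  have hreduce : ∀ t : ℝ, (∀ p a : X, α * ‖p‖ ^ 2 ≤ ⟪p, a⟫ → ‖a‖ ≤ ℓ * ‖p‖ →
      2 * ν * lam * (‖p‖ ^ 2 + γ * ⟪p, a⟫) + lam ^ 2 * ‖p‖ ^ 2 ≤
        t * (‖p‖ ^ 2 + 2 * γ * ⟪p, a⟫ + γ ^ 2 * ‖a‖ ^ 2)) →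
      ∀ x y : X, ‖(ν • x + lam • J x) - (ν • y + lam • J y)‖ ≤ √(ν ^ 2 + t) * ‖x - y‖ := by
    intro t ht x y
    have hd : x - y = (J x - J y) + γ • (A (J x) - A (J y)) := by
      conv_lhs => rw [← hJ x, ← hJ y]
      module
    have hQ : (ν • x + lam • J x) - (ν • y + lam • J y) = ν • (x - y) + lam • (J x - J y) := by
      module
    rw [hQ, hd]
    exact norm_smul_add_smul_le_sqrt_mul_norm _ _ _ _ _ _ (ht _ _ (hmono _ _) (hlip _ _))
  have himproved : 0 ≤ lam * ν * (1 - γ ^ 2 * ℓ ^ 2) + lam ^ 2 →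
      ∀ x y : X, ‖(ν • x + lam • J x) - (ν • y + lam • J y)‖ ≤ ρ' * ‖x - y‖ := by
    intro hc
    refine hreduce _ fun p a hm hl => ?_
    have hN : ‖a‖ ^ 2 ≤ ℓ ^ 2 * ‖p‖ ^ 2 := by
      rw [← mul_pow]
      exact pow_le_pow_left₀ (norm_nonneg _) hl 2
    rw [div_mul_eq_mul_div, le_div_iff₀ hE]
    have h1 : 0 ≤ γ * (⟪p, a⟫ - α * ‖p‖ ^ 2) * (lam * ν * (1 - γ ^ 2 * ℓ ^ 2) + lam ^ 2) :=
      mul_nonneg (mul_nonneg hγ.le (sub_nonneg.2 hm)) hc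
    have h2 : 0 ≤ -(lam * (2 * ν * (1 + γ * α) + lam)) * (γ ^ 2 * (ℓ ^ 2 * ‖p‖ ^ 2 - ‖a‖ ^ 2)) :=
      mul_nonneg (neg_nonneg.2 h) (mul_nonneg (sq_nonneg γ) (sub_nonneg.2 hN))
    linarith
  by_cases hc : 1 ≤ γ * ℓ
  · have hρ : ρ = ρ' := by
      simp only [ρ, ρ', αJ, if_pos hc, mul_one_div]
    have hL : ∀ x y : X, ‖(ν • x + lam • J x) - (ν • y + lam • J y)‖ ≤ ρ' * ‖x - y‖ := by
      refine himproved ?_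
      have : 1 ≤ γ ^ 2 * ℓ ^ 2 := by nlinarith
      nlinarith [mul_nonneg (neg_nonneg.2 hνlam) (sub_nonneg.2 this), sq_nonneg lam]
    exact ⟨hρ ▸ hL, fun _ => ⟨hL, hρ.ge⟩⟩
  · push Not at hc
    have hb : 0 < (1 + γ * α) * (1 + γ * ℓ) := mul_pos hpos (by linarith)
    have hαJ : αJ = 1 / ((1 + γ * α) * (1 + γ * ℓ)) := if_neg hc.not_ge
    refine ⟨hreduce _ fun p a hm hl => ?_, fun hcond => ⟨himproved ?_, ?_⟩⟩
    · have hN : ‖a‖ ^ 2 ≤ ℓ ^ 2 * ‖p‖ ^ 2 := by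
        rw [← mul_pow]
        exact pow_le_pow_left₀ (norm_nonneg _) hl 2
      have hS : ⟪p, a⟫ ≤ ℓ * ‖p‖ ^ 2 := by
        nlinarith [real_inner_le_norm p a, mul_le_mul_of_nonneg_left hl (norm_nonneg p)]
      have hD : ‖p‖ ^ 2 + 2 * γ * ⟪p, a⟫ + γ ^ 2 * ‖a‖ ^ 2 ≤
          (1 + γ * ℓ) * (‖p‖ ^ 2 + γ * ⟪p, a⟫) := by
        have h1 : 0 ≤ γ * (1 - γ * ℓ) * (ℓ * ‖p‖ ^ 2 - ⟪p, a⟫) :=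
          mul_nonneg (mul_nonneg hγ.le (by linarith)) (sub_nonneg.2 hS)
        have h2 : 0 ≤ γ ^ 2 * (ℓ ^ 2 * ‖p‖ ^ 2 - ‖a‖ ^ 2) :=
          mul_nonneg (sq_nonneg γ) (sub_nonneg.2 hN)
        linarith
      rw [hαJ, mul_one_div, div_mul_eq_mul_div, le_div_iff₀ hb]
      have h1 := mul_le_mul_of_nonpos_left hD h
      have h2 : 0 ≤ lam ^ 2 * (1 + γ * ℓ) * (γ * (⟪p, a⟫ - α * ‖p‖ ^ 2)) :=
        mul_nonneg (mul_nonneg (sq_nonneg lam) (by linarith))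
          (mul_nonneg hγ.le (sub_nonneg.2 hm))
      linarith
    · have hu : 0 < 1 - γ ^ 2 * ℓ ^ 2 := by nlinarith
      have := mul_nonneg (hcond hc) hu.le
      have he : lam * (ν + lam / (1 - γ ^ 2 * ℓ ^ 2)) * (1 - γ ^ 2 * ℓ ^ 2) =
          lam * ν * (1 - γ ^ 2 * ℓ ^ 2) + lam ^ 2 := by
        field_simp
      exact he ▸ this
    · refine Real.sqrt_le_sqrt (add_le_add_right ?_ _)
      rw [hαJ, div_eq_mul_one_div]
      refine mul_le_mul_of_nonpos_left (one_div_le_one_div_of_le hE ?_) h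
      have : 0 ≤ γ * (ℓ - α) * (1 - γ * ℓ) :=
        mul_nonneg (mul_nonneg hγ.le (by linarith)) (by linarith)
      linarith
end

section
/- Let X be a real Hilbert space, let A: X → X be α-monotone and Lipschitz continuous with constant ℓ, where |α| ≤ ℓ, and let γ > 0 and λ > 0 satisfy 1 + γα > 0 and λ(1 + 2γα) − 2(1 + γα) ≥ 0. Let J: X → X satisfy J x + γ·A(J x) = x for all x ∈ X, and define R := (1−λ)·Id + λ·J. Then R is Lipschitz continuous with constant √((λ−1)² − λ((λ−1)(2+2γα) − λ)/(1 + 2γα + γ²ℓ²)). -/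
open Pointwise RealInnerProductSpace Filter

variable {X : Type*} [NormedAddCommGroup X] [InnerProductSpace ℝ X]

theorem stmt12 (A : X → X) (α ℓ : ℝ) (hαℓ : |α| ≤ ℓ)
    (hmono : ∀ x y : X, α * ‖x - y‖ ^ 2 ≤ ⟪x - y, A x - A y⟫)
    (hlip : ∀ x y : X, ‖A x - A y‖ ≤ ℓ * ‖x - y‖)
    (γ lam : ℝ) (hγ : 0 < γ) (hlam : 0 < lam)
    (hpos : 0 < 1 + γ * α) (hcond : 0 ≤ lam * (1 + 2 * γ * α) - 2 * (1 + γ * α))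
    (J : X → X) (hJ : ∀ x, J x + γ • A (J x) = x) :
    ∀ x y : X,
      ‖((1 - lam) • x + lam • J x) - ((1 - lam) • y + lam • J y)‖ ≤
        Real.sqrt ((lam - 1) ^ 2 -
            lam * ((lam - 1) * (2 + 2 * γ * α) - lam) / (1 + 2 * γ * α + γ ^ 2 * ℓ ^ 2)) *
          ‖x - y‖ := by
  intro x y
  set p := J x - J y with hp
  set q := A (J x) - A (J y) with hq
  have hd : x - y = p + γ • q := by
    calc x - y = (J x + γ • A (J x)) - (J y + γ • A (J y)) := by rw [hJ, hJ]
      _ = p + γ • q := by rw [hp, hq, smul_sub]; abel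
  have hR : ((1 - lam) • x + lam • J x) - ((1 - lam) • y + lam • J y) =
      p + ((1 - lam) * γ) • q := by
    calc _ = (1 - lam) • (x - y) + lam • p := by rw [hp]; module
      _ = p + ((1 - lam) * γ) • q := by rw [hd]; module
  have hnorm (c : ℝ) : ‖p + c • q‖ ^ 2 = ‖p‖ ^ 2 + 2 * c * ⟪p, q⟫ + c ^ 2 * ‖q‖ ^ 2 := by
    rw [norm_add_sq_real, real_inner_smul_right, norm_smul, mul_pow, Real.norm_eq_abs, sq_abs]
    ring
  have hs : α * ‖p‖ ^ 2 ≤ ⟪p, q⟫ := hmono _ _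
  have hQ : ‖q‖ ^ 2 ≤ ℓ ^ 2 * ‖p‖ ^ 2 := by
    rw [← mul_pow]
    exact pow_le_pow_left₀ (norm_nonneg _) (hlip _ _) 2
  have hα : α ^ 2 ≤ ℓ ^ 2 := sq_le_sq.mpr (hαℓ.trans (le_abs_self ℓ))
  have hD : 0 < 1 + 2 * γ * α + γ ^ 2 * ℓ ^ 2 := by
    nlinarith [mul_le_mul_of_nonneg_left hα (sq_nonneg γ), pow_pos hpos 2]
  have hlam1 : 1 < lam := by
    by_contra! h
    nlinarith [mul_nonneg hpos.le (sub_nonneg.mpr h)]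
  rw [hR, hd, ← Real.sqrt_sq (norm_nonneg (p + γ • q)), ← Real.sqrt_mul' _ (sq_nonneg _)]
  apply Real.le_sqrt_of_sq_le
  rw [hnorm, hnorm]
  generalize ⟪p, q⟫ = s at *
  generalize ‖p‖ ^ 2 = P at *
  generalize ‖q‖ ^ 2 = Q at *
  have hN : 0 ≤ (lam - 1) * (2 + 2 * γ * α) - lam := by linarith
  have hkey : ((lam - 1) * (2 + 2 * γ * α) - lam) * (P + 2 * γ * s + γ ^ 2 * Q) ≤
      ((lam - 2) * P + 2 * γ * (lam - 1) * s) * (1 + 2 * γ * α + γ ^ 2 * ℓ ^ 2) := by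
    have h₁ := mul_nonneg (mul_nonneg hN (sq_nonneg γ)) (sub_nonneg.mpr hQ)
    have h₂ : 0 ≤ (lam - 1) * γ ^ 2 * ℓ ^ 2 + 1 := by
      have := sub_pos.mpr hlam1
      positivity
    have h₃ := mul_nonneg (mul_nonneg hγ.le h₂) (sub_nonneg.mpr hs)
    linear_combination h₁ + 2 * h₃
  have hdiv := mul_le_mul_of_nonneg_left ((div_le_iff₀ hD).mpr hkey) hlam.le
  linear_combination hdiv
end

section
/- Let X be a real Hilbert space, let A: X → X be α-monotone and Lipschitz continuous with constant ℓ, where |α| ≤ ℓ, and let γ > 0 and λ > 0 satisfy 1 + γα > 0 and λ(1 + 2γα) − 2(1 + γα) ≥ 0. Let J: X → X satisfy J x + γ·A(J x) = x for all x ∈ X, define R := (1−λ)·Id + λ·J, and let ε ≥ 0; define Q := Id − ε·R. Then Q is Lipschitz continuous with constant √((1 + ε(λ−1))² − ελ·[2(1+γα) + ε(λ(1+2γα) − 2(1+γα))]·α_J), where α_J = 1/(1 + 2γα + γ²ℓ²) if γℓ ≥ 1 and α_J = 1/((1+γα)(1+γℓ)) if γℓ ≤ 1. -/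
open Pointwise RealInnerProductSpace Filter

variable {X : Type*} [NormedAddCommGroup X] [InnerProductSpace ℝ X]

/-- The resolvent estimate underlying the Lipschitz bound, with `p` the difference of resolvents and
`a` the difference of the corresponding images. -/
theorem resolvent_inner_estimate (p a : X) (b L c d K : ℝ) (hL : 0 ≤ L) (hb : 0 < 1 + b)
    (hmono : b * ‖p‖ ^ 2 ≤ ⟪p, a⟫) (hlip : ‖a‖ ≤ L * ‖p‖) (hd : 0 ≤ d) (hK : 0 ≤ K)
    (hKc : K = 2 * c * (1 + b) - d) :
    K * (if 1 ≤ L then 1 / (1 + 2 * b + L ^ 2) else 1 / ((1 + b) * (1 + L))) * ‖p + a‖ ^ 2 ≤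
      2 * c * ⟪p + a, p⟫ - d * ‖p‖ ^ 2 := by
  have hz : ‖p + a‖ ^ 2 = ‖p‖ ^ 2 + 2 * ⟪p, a⟫ + ‖a‖ ^ 2 := norm_add_sq_real p a
  have hzp : ⟪p + a, p⟫ = ‖p‖ ^ 2 + ⟪p, a⟫ := by
    rw [inner_add_left, real_inner_self_eq_norm_sq, real_inner_comm]
  have hcs : ⟪p, a⟫ ≤ ‖p‖ * ‖a‖ := real_inner_le_norm p a
  rw [hz, hzp]
  have hp := norm_nonneg p
  have ha := norm_nonneg a
  generalize ‖p‖ = r at *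
  generalize ‖a‖ = n at *
  generalize ⟪p, a⟫ = s at *
  have hc : 0 ≤ c := by
    by_contra! h
    nlinarith [mul_neg_of_neg_of_pos h hb]
  have hn : n ^ 2 ≤ L ^ 2 * r ^ 2 := by
    rw [← mul_pow]
    exact pow_le_pow_left₀ ha hlip 2
  split_ifs with h
  · have hD : 2 * (1 + b) ≤ 1 + 2 * b + L ^ 2 := by nlinarith
    have hD0 : 0 < 1 + 2 * b + L ^ 2 := by linarith
    rw [mul_one_div, div_mul_eq_mul_div, div_le_iff₀ hD0]
    have h₁ : K ≤ c * (1 + 2 * b + L ^ 2) := by nlinarith [mul_le_mul_of_nonneg_left hD hc]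
    have h₂ := mul_le_mul_of_nonneg_left hn hK
    have h₃ := mul_le_mul_of_nonneg_right h₁ (sub_nonneg.2 hmono)
    have h₄ : d = 2 * c * (1 + b) - K := by linarith
    subst h₄
    linarith
  · have hD0 : 0 < (1 + b) * (1 + L) := by positivity
    rw [mul_one_div, div_mul_eq_mul_div, div_le_iff₀ hD0]
    have h₁ : r ^ 2 + 2 * s + n ^ 2 ≤ (1 + L) * (r ^ 2 + s) := by
      have h₅ := mul_le_mul_of_nonneg_left hcs (by linarith : 0 ≤ 1 - L)
      have h₆ := mul_nonneg (sub_nonneg.2 hlip) (add_nonneg hp ha)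
      linarith
    have h₂ := mul_le_mul_of_nonneg_left h₁ hK
    have h₃ : 0 ≤ d * (s - b * r ^ 2) * (1 + L) :=
      mul_nonneg (mul_nonneg hd (sub_nonneg.2 hmono)) (by linarith)
    subst hKc
    linarith

theorem stmt13 (A : X → X) (α ℓ : ℝ) (hαℓ : |α| ≤ ℓ)
    (hmono : ∀ x y : X, α * ‖x - y‖ ^ 2 ≤ ⟪x - y, A x - A y⟫)
    (hlip : ∀ x y : X, ‖A x - A y‖ ≤ ℓ * ‖x - y‖)
    (γ lam : ℝ) (hγ : 0 < γ) (hlam : 0 < lam)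
    (hpos : 0 < 1 + γ * α) (hcond : 0 ≤ lam * (1 + 2 * γ * α) - 2 * (1 + γ * α))
    (J : X → X) (hJ : ∀ x, J x + γ • A (J x) = x)
    (ε : ℝ) (hε : 0 ≤ ε) :
    let R : X → X := fun x => (1 - lam) • x + lam • J x
    let Q : X → X := fun x => x - ε • R x
    let αJ : ℝ :=
      if 1 ≤ γ * ℓ then 1 / (1 + 2 * γ * α + γ ^ 2 * ℓ ^ 2)
      else 1 / ((1 + γ * α) * (1 + γ * ℓ))
    ∀ x y : X,
      ‖Q x - Q y‖ ≤
        Real.sqrt ((1 + ε * (lam - 1)) ^ 2 -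
            ε * lam * (2 * (1 + γ * α) + ε * (lam * (1 + 2 * γ * α) - 2 * (1 + γ * α))) * αJ) *
          ‖x - y‖ := by
  intro R Q αJ x y
  have hl : 0 ≤ ℓ := (abs_nonneg α).trans hαℓ
  set p := J x - J y with hp
  set a := γ • (A (J x) - A (J y)) with ha
  have hz : x - y = p + a := by
    nth_rewrite 1 [← hJ x, ← hJ y]
    rw [hp, ha]
    module
  have hQ : Q x - Q y = (1 + ε * (lam - 1)) • (p + a) - (ε * lam) • p := by
    rw [← hz, hp]
    simp only [Q, R]
    module
  have hpa : (γ * α) * ‖p‖ ^ 2 ≤ ⟪p, a⟫ := by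
    rw [ha, real_inner_smul_right, mul_assoc]
    exact mul_le_mul_of_nonneg_left (hmono _ _) hγ.le
  have hap : ‖a‖ ≤ (γ * ℓ) * ‖p‖ := by
    rw [ha, norm_smul, Real.norm_of_nonneg hγ.le, mul_assoc]
    exact mul_le_mul_of_nonneg_left (hlip _ _) hγ.le
  have hK : 0 ≤ 2 * (1 + γ * α) + ε * (lam * (1 + 2 * γ * α) - 2 * (1 + γ * α)) := by
    have := mul_nonneg hε hcond
    linarith
  have key := resolvent_inner_estimate p a (γ * α) (γ * ℓ) (1 + ε * (lam - 1)) (ε * lam) _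
    (by positivity) hpos hpa hap (by positivity) hK (by ring)
  have hαJ : (if 1 ≤ γ * ℓ then 1 / (1 + 2 * (γ * α) + (γ * ℓ) ^ 2)
      else 1 / ((1 + γ * α) * (1 + γ * ℓ))) = αJ := by
    simp only [αJ, mul_pow, mul_assoc]
  rw [hαJ] at key
  rw [hz, hQ, ← Real.sqrt_sq (norm_nonneg (p + a)), ← Real.sqrt_mul' _ (sq_nonneg _)]
  apply Real.le_sqrt_of_sq_le
  rw [norm_sub_sq_real, norm_smul, norm_smul, mul_pow, mul_pow, real_inner_smul_left,
    real_inner_smul_right, Real.norm_eq_abs, Real.norm_eq_abs, sq_abs, sq_abs]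
  have := mul_le_mul_of_nonneg_left key (by positivity : 0 ≤ ε * lam)
  linarith
end

section
/- Let X be a real Hilbert space, let A: X ⇒ X be α-monotone and B: X ⇒ X be β-monotone, let γ, δ > 0 and λ, μ ≥ 1 with λ, μ > 1 satisfying (λ−1)(μ−1) = 1 and δ = (λ−1)γ, and let κ ∈ (0,1). Suppose J₁, J₂: X → X satisfy x − J₁x ∈ γ·A(J₁x) and x − J₂x ∈ δ·B(J₂x) for all x ∈ X, and define R₁ := (1−λ)·Id + λ·J₁, R₂ := (1−μ)·Id + μ·J₂, and T := (1−κ)·Id + κ·(R₂ ∘ R₁). Then for all x, y ∈ X: ‖Tx − Ty‖² ≤ ‖x − y‖² − ((1−κ)/κ)‖(x − Tx) − (y − Ty)‖² − κμ(2 + 2γα − μ)‖J₁x − J₁y‖² − κμ(μ − (2 − 2γβ))‖J₂(R₁x) − J₂(R₁y)‖². -/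
open Pointwise RealInnerProductSpace Filter

variable {X : Type*} [NormedAddCommGroup X] [InnerProductSpace ℝ X]

/-- A displacement inequality for selections of the resolvent of an `α`-monotone operator. -/
theorem AlphaMonotone.resolvent_inner_le {α : ℝ} {A : X → Set X} (hA : AlphaMonotone α A)
    {γ : ℝ} (hγ : 0 < γ) {J : X → X} (hJ : ∀ x, x - J x ∈ γ • A (J x)) (x y : X) :
    (1 + γ * α) * ‖J x - J y‖ ^ 2 ≤ ⟪x - y, J x - J y⟫ := by
  obtain ⟨u, hu, hux⟩ := hJ x
  obtain ⟨v, hv, hvy⟩ := hJ y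
  have h := mul_le_mul_of_nonneg_left (hA hu hv) hγ.le
  have hdecomp : x - y = (J x - J y) + γ • (u - v) := by
    simp only at hux hvy
    rw [smul_sub, hux, hvy]
    abel
  have hinner : ⟪x - y, J x - J y⟫ = ‖J x - J y‖ ^ 2 + γ * ⟪J x - J y, u - v⟫ := by
    rw [hdecomp, inner_add_left, real_inner_self_eq_norm_sq, real_inner_smul_left,
      real_inner_comm (J x - J y)]
  linarith

theorem norm_smul_add_smul_sq (p q : ℝ) (a b : X) :
    ‖p • a + q • b‖ ^ 2 = p ^ 2 * ‖a‖ ^ 2 + 2 * p * q * ⟪a, b⟫ + q ^ 2 * ‖b‖ ^ 2 := by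
  rw [norm_add_sq_real, real_inner_smul_left, real_inner_smul_right, norm_smul, norm_smul,
    mul_pow, mul_pow, Real.norm_eq_abs, Real.norm_eq_abs, sq_abs, sq_abs]
  ring

theorem stmt15 (A B : X → Set X) (α β : ℝ)
    (hA : AlphaMonotone α A) (hB : AlphaMonotone β B)
    (γ δ lam μ : ℝ) (hγ : 0 < γ) (hδ : 0 < δ)
    (hlam : 1 < lam) (hμ : 1 < μ)
    (h4 : (lam - 1) * (μ - 1) = 1) (h5 : δ = (lam - 1) * γ)
    (κ : ℝ) (hκ : κ ∈ Set.Ioo (0 : ℝ) 1)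
    (J₁ J₂ : X → X)
    (hJ₁ : ∀ x, x - J₁ x ∈ γ • A (J₁ x)) (hJ₂ : ∀ x, x - J₂ x ∈ δ • B (J₂ x))
    (R₁ R₂ T : X → X)
    (hR₁ : ∀ z, R₁ z = (1 - lam) • z + lam • J₁ z)
    (hR₂ : ∀ z, R₂ z = (1 - μ) • z + μ • J₂ z)
    (hT : ∀ z, T z = (1 - κ) • z + κ • R₂ (R₁ z)) :
    ∀ x y : X,
      ‖T x - T y‖ ^ 2 ≤ ‖x - y‖ ^ 2
        - ((1 - κ) / κ) * ‖(x - T x) - (y - T y)‖ ^ 2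
        - κ * μ * (2 + 2 * γ * α - μ) * ‖J₁ x - J₁ y‖ ^ 2
        - κ * μ * (μ - (2 - 2 * γ * β)) * ‖J₂ (R₁ x) - J₂ (R₁ y)‖ ^ 2 := by
  intro x y
  have hκ0 : κ ≠ 0 := hκ.1.ne'
  have h₁ := hA.resolvent_inner_le hγ hJ₁ x y
  have h₂ := hB.resolvent_inner_le hδ hJ₂ (R₁ x) (R₁ y)
  have hr : R₁ x - R₁ y = (1 - lam) • (x - y) + lam • (J₁ x - J₁ y) := by
    rw [hR₁, hR₁]; module
  have hs : R₂ (R₁ x) - R₂ (R₁ y) =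
      (1 - μ) • (R₁ x - R₁ y) + μ • (J₂ (R₁ x) - J₂ (R₁ y)) := by
    rw [hR₂, hR₂]; module
  have ht : T x - T y = (1 - κ) • (x - y) + κ • (R₂ (R₁ x) - R₂ (R₁ y)) := by
    rw [hT, hT]; module
  have hd : (x - T x) - (y - T y) = κ • (x - y) + (-κ) • (R₂ (R₁ x) - R₂ (R₁ y)) := by
    rw [hT, hT]; module
  rw [ht, hd]
  generalize x - y = a at *
  generalize J₁ x - J₁ y = b at *
  generalize J₂ (R₁ x) - J₂ (R₁ y) = c at *
  generalize R₁ x - R₁ y = r at *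
  generalize R₂ (R₁ x) - R₂ (R₁ y) = s at *
  have hγδ : (μ - 1) * δ = γ := by rw [h5]; linear_combination γ * h4
  have hr_sq : (μ - 1) ^ 2 * ‖r‖ ^ 2 = ‖a‖ ^ 2 - 2 * μ * ⟪a, b⟫ + μ ^ 2 * ‖b‖ ^ 2 := by
    have hscaled : (μ - 1) • r = (-1 : ℝ) • a + μ • b := by
      rw [hr, smul_add, smul_smul, smul_smul]
      congr 2
      · linear_combination -h4
      · linear_combination h4
    have h := norm_smul_add_smul_sq (-1) μ a b
    rw [← hscaled, norm_smul, mul_pow, Real.norm_eq_abs, sq_abs] at h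
    linarith
  have hs_sq : ‖s‖ ^ 2 ≤ ‖a‖ ^ 2 - μ * (2 + 2 * γ * α - μ) * ‖b‖ ^ 2
      - μ * (μ - (2 - 2 * γ * β)) * ‖c‖ ^ 2 := by
    have hμ0 : 0 ≤ 2 * μ := by linarith
    have hμ1 : 0 ≤ 2 * μ * (μ - 1) := mul_nonneg hμ0 (by linarith)
    have h₁' := mul_le_mul_of_nonneg_left h₁ hμ0
    have h₂' := mul_le_mul_of_nonneg_left h₂ hμ1
    rw [hs, norm_smul_add_smul_sq]
    have hβ : 2 * μ * (μ - 1) * ((1 + δ * β) * ‖c‖ ^ 2) =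
        2 * μ * (μ - 1 + γ * β) * ‖c‖ ^ 2 := by
      linear_combination 2 * μ * β * ‖c‖ ^ 2 * hγδ
    linarith
  have hκs := mul_le_mul_of_nonneg_left hs_sq hκ.1.le
  rw [norm_smul_add_smul_sq, norm_smul_add_smul_sq]
  have hcancel : (1 - κ) / κ * (κ ^ 2 * ‖a‖ ^ 2 + 2 * κ * -κ * ⟪a, s⟫ + (-κ) ^ 2 * ‖s‖ ^ 2) =
      (1 - κ) * κ * (‖a‖ ^ 2 - 2 * ⟪a, s⟫ + ‖s‖ ^ 2) := by
    field_simp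
    ring
  rw [hcancel]
  linarith
end

section
/- Let X be a real Hilbert space. Suppose A: X → X is α-monotone and Lipschitz continuous with constant ℓ, where |α| ≤ ℓ, B: X ⇒ X is maximally β-monotone, α + β > 0, and zer(A+B) := {x : −A x ∈ B x} is nonempty. Let γ, δ > 0 and λ, μ > 1 satisfy 1 + 2γα > 0, 2 − 2γβ ≤ μ ≤ 2 + 2γα, (λ−1)(μ−1) = 1, δ = (λ−1)γ, and let κ ∈ (0,1). Let J₁: X → X satisfy J₁x + γ·A(J₁x) = x for all x, and J₂: X → X satisfy x − J₂x ∈ δ·B(J₂x) for all x; define R₁ := (1−λ)·Id + λ·J₁, R₂ := (1−μ)·Id + μ·J₂, T := (1−κ)·Id + κ·(R₂ ∘ R₁). Set ε := (μ − (2 − 2γβ))/(2(1+δβ)), ε₁ := κε/(1−κ), φ := ε₁λ·[2(1+γα) + ε₁(λ(1+2γα) − 2(1+γα))], and α_J := 1/(1 + 2γα + γ²ℓ²) if γℓ ≥ 1, α_J := 1/((1+γα)(1+γℓ)) if γℓ ≤ 1. Then T is Lipschitz continuous with constant ρ := (1−κ)·√((1 + ε₁(λ−1))² − φ·α_J) +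 κ·(1 − ε(λ−1))·√(1 − μ(2 + 2γα − μ)/(1 + 2γα + γ²ℓ²)), and ρ < 1. Consequently, T has a unique fixed point x̄ and every sequence x_{n+1} = T x_n converges strongly to x̄ with ‖x_{n+1} − x̄‖ ≤ ρ‖x_n − x̄‖ for all n. -/
open Pointwise RealInnerProductSpace Filter

variable {X : Type*} [NormedAddCommGroup X] [InnerProductSpace ℝ X]

/-- The scalar estimate behind the Lipschitz constant of the relaxed resolvent of `γA`. -/
lemma relaxed_resolvent_scalar_bound {n t m g L μ : ℝ} (hg : g * n ≤ t) (hm : m ≤ L ^ 2 * n)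
    (hμ : 1 < μ) (h : μ ≤ 2 + 2 * g) :
    (2 + 2 * g - μ) * (n + 2 * t + m) ≤
      (1 + 2 * g + L ^ 2) * (2 * t + (2 - μ) * n) := by
  have h1 : 0 ≤ (t - g * n) * (L ^ 2 + μ - 1) :=
    mul_nonneg (by linarith) (by nlinarith [sq_nonneg L])
  have h2 : 0 ≤ (2 + 2 * g - μ) * (L ^ 2 * n - m) := mul_nonneg (by linarith) (by linarith)
  linarith

/-- Strong monotonicity of the resolvent of `γA` when `1 ≤ γℓ`, in scalar form. -/
lemma resolvent_scalar_bound_of_one_le {n t m g L c e : ℝ} (hg : g * n ≤ t)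
    (hm : m ≤ L ^ 2 * n) (hL : 1 ≤ L) (hc : 0 ≤ c) (he : 0 ≤ e)
    (hψ : 0 ≤ 2 * c * (1 + g) - e) :
    (2 * c * (1 + g) - e) * (n + 2 * t + m) ≤
      (2 * c * (n + t) - e * n) * (1 + 2 * g + L ^ 2) := by
  have h1 : 0 ≤ (t - g * n) * (c * (L ^ 2 - 1) + e) :=
    mul_nonneg (by linarith) (add_nonneg (mul_nonneg hc (by nlinarith)) he)
  have h2 : 0 ≤ (2 * c * (1 + g) - e) * (L ^ 2 * n - m) := mul_nonneg hψ (by linarith)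
  linarith

/-- Strong monotonicity of the resolvent of `γA` when `γℓ ≤ 1`, in scalar form. -/
lemma resolvent_scalar_bound_of_le_one {n t m g L c e : ℝ} (hg : g * n ≤ t)
    (hm : m ≤ L ^ 2 * n) (ht : t ≤ L * n) (hL0 : 0 ≤ L) (hL : L ≤ 1) (he : 0 ≤ e)
    (hψ : 0 ≤ 2 * c * (1 + g) - e) :
    (2 * c * (1 + g) - e) * (n + 2 * t + m) ≤
      (2 * c * (n + t) - e * n) * ((1 + g) * (1 + L)) := by
  have h1 : 0 ≤ (t - g * n) * (e * (1 + L)) :=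
    mul_nonneg (by linarith) (mul_nonneg he (by linarith))
  have h2 : 0 ≤ (L * n - t) * ((2 * c * (1 + g) - e) * (1 - L)) :=
    mul_nonneg (by linarith) (mul_nonneg hψ (by linarith))
  have h3 : 0 ≤ (2 * c * (1 + g) - e) * (L ^ 2 * n - m) := mul_nonneg hψ (by linarith)
  linarith

lemma norm_le_sqrt_mul_norm {E : Type*} [SeminormedAddCommGroup E] {v d : E} {K : ℝ} (h : ‖v‖ ^ 2 ≤ K * ‖d‖ ^ 2) :
    ‖v‖ ≤ Real.sqrt K * ‖d‖ := by
  have := Real.sqrt_le_sqrt h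
  rwa [Real.sqrt_sq (norm_nonneg _), Real.sqrt_mul' _ (sq_nonneg _),
    Real.sqrt_sq (norm_nonneg _)] at this

/-- If `p` is the resolvent image of `p + q`, the relaxed point `p - θ⁻¹ q` lies in the ball
around `-ε (p + q)` of radius `(1 - ε θ) θ⁻¹ ‖p + q‖`. -/
lemma norm_relaxed_resolvent_add_le {p q : X} {θ ε k : ℝ} (hθ : 0 < θ) (hk : 0 < k)
    (hε : 1 + θ = 2 * k * (1 - ε * θ)) (hpq : k * ‖p‖ ^ 2 ≤ ⟪p, p + q⟫) :
    θ * ‖p - θ⁻¹ • q + ε • (p + q)‖ ≤ (1 - ε * θ) * ‖p + q‖ := by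
  have hν : 0 ≤ 1 - ε * θ := by
    by_contra! h
    nlinarith
  have e1 : p - θ⁻¹ • q + ε • (p + q) =
      (θ⁻¹ * (1 - ε * θ)) • ((2 * k) • p - (p + q)) := by
    have h2 : θ⁻¹ * (1 - ε * θ) * (2 * k) = θ⁻¹ + 1 := by
      field_simp
      linarith
    have h3 : θ⁻¹ * (1 - ε * θ) = θ⁻¹ - ε := by field_simp
    rw [smul_sub, smul_smul, h2, h3]
    module
  have e2 : ‖(2 * k) • p - (p + q)‖ ≤ ‖p + q‖ := by
    refine le_of_sq_le_sq ?_ (norm_nonneg _)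
    rw [norm_sub_sq_real, norm_smul, real_inner_smul_left, mul_pow, Real.norm_eq_abs, sq_abs]
    nlinarith
  rw [e1, norm_smul, Real.norm_of_nonneg (by positivity)]
  calc θ * (θ⁻¹ * (1 - ε * θ) * ‖(2 * k) • p - (p + q)‖)
      = (1 - ε * θ) * ‖(2 * k) • p - (p + q)‖ := by field_simp
    _ ≤ _ := by gcongr

/-- A contraction of a complete space has a unique fixed point, to which its orbits converge. -/
lemma exists_fixedPoint_of_norm_sub_le {E : Type*} [NormedAddCommGroup E] [CompleteSpace E]
    {T : E → E} {ρ : ℝ} (h0 : 0 ≤ ρ)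
    (h1 : ρ < 1) (hT : ∀ x y : E, ‖T x - T y‖ ≤ ρ * ‖x - y‖) :
    ∃ xbar : E, T xbar = xbar ∧ (∀ y : E, T y = y → y = xbar) ∧
      ∀ x : ℕ → E, (∀ n, x (n + 1) = T (x n)) →
        Tendsto x atTop (nhds xbar) ∧ ∀ n, ‖x (n + 1) - xbar‖ ≤ ρ * ‖x n - xbar‖ := by
  have hc : ContractingWith ⟨ρ, h0⟩ T := by
    refine ⟨by exact_mod_cast h1, LipschitzWith.of_dist_le_mul fun x y => ?_⟩
    rw [dist_eq_norm, dist_eq_norm]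
    exact hT x y
  have hfix : T (hc.fixedPoint T) = hc.fixedPoint T := hc.fixedPoint_isFixedPt
  refine ⟨hc.fixedPoint T, hfix, fun y hy => hc.fixedPoint_unique hy, fun x hx => ⟨?_, ?_⟩⟩
  · have hiter : x = fun n => T^[n] (x 0) := by
      funext n
      induction n with
      | zero => rfl
      | succ n ih => rw [hx, Function.iterate_succ_apply', ← ih]
    rw [hiter]
    exact hc.tendsto_iterate_fixedPoint (x 0)
  · intro n
    have := hT (x n) (hc.fixedPoint T)
    rwa [hfix, ← hx] at this

set_option maxHeartbeats 400000 in
theorem stmt18 [CompleteSpace X] (A : X → X) (B : X → Set X) (α β ℓ : ℝ)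
    (hαℓ : |α| ≤ ℓ)
    (hAmono : ∀ x y : X, α * ‖x - y‖ ^ 2 ≤ ⟪x - y, A x - A y⟫)
    (hAlip : ∀ x y : X, ‖A x - A y‖ ≤ ℓ * ‖x - y‖)
    (hB : MaxAlphaMonotone β B)
    (hαβ : 0 < α + β)
    (hzer : ∃ z : X, -A z ∈ B z)
    (γ δ lam μ : ℝ) (hγ : 0 < γ) (hδ : 0 < δ) (hlam : 1 < lam) (hμ : 1 < μ)
    (h1 : 0 < 1 + 2 * γ * α) (h2 : 2 - 2 * γ * β ≤ μ) (h3 : μ ≤ 2 + 2 * γ * α)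
    (h4 : (lam - 1) * (μ - 1) = 1) (h5 : δ = (lam - 1) * γ)
    (κ : ℝ) (hκ : κ ∈ Set.Ioo (0 : ℝ) 1)
    (J₁ : X → X) (hJ₁ : ∀ x, J₁ x + γ • A (J₁ x) = x)
    (J₂ : X → X) (hJ₂ : ∀ x, x - J₂ x ∈ δ • B (J₂ x))
    (R₁ R₂ T : X → X)
    (hR₁ : ∀ z, R₁ z = (1 - lam) • z + lam • J₁ z)
    (hR₂ : ∀ z, R₂ z = (1 - μ) • z + μ • J₂ z)
    (hT : ∀ z, T z = (1 - κ) • z + κ • R₂ (R₁ z)) :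
    let ε : ℝ := (μ - (2 - 2 * γ * β)) / (2 * (1 + δ * β))
    let ε₁ : ℝ := κ * ε / (1 - κ)
    let φ : ℝ := ε₁ * lam * (2 * (1 + γ * α) + ε₁ * (lam * (1 + 2 * γ * α) - 2 * (1 + γ * α)))
    let αJ : ℝ :=
      if 1 ≤ γ * ℓ then 1 / (1 + 2 * γ * α + γ ^ 2 * ℓ ^ 2)
      else 1 / ((1 + γ * α) * (1 + γ * ℓ))
    let ρ : ℝ := (1 - κ) * Real.sqrt ((1 + ε₁ * (lam - 1)) ^ 2 - φ * αJ) +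
      κ * (1 - ε * (lam - 1)) *
        Real.sqrt (1 - μ * (2 + 2 * γ * α - μ) / (1 + 2 * γ * α + γ ^ 2 * ℓ ^ 2))
    (∀ x y : X, ‖T x - T y‖ ≤ ρ * ‖x - y‖) ∧ ρ < 1 ∧
      ∃ xbar : X, T xbar = xbar ∧ (∀ y : X, T y = y → y = xbar) ∧
        ∀ x : ℕ → X, (∀ n, x (n + 1) = T (x n)) →
          Tendsto x atTop (nhds xbar) ∧ ∀ n, ‖x (n + 1) - xbar‖ ≤ ρ * ‖x n - xbar‖ := by
  intro ε ε₁ φ αJ ρ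
  obtain ⟨hκ0, hκ1⟩ := hκ
  have hκ1' : 0 < 1 - κ := by linarith
  obtain ⟨θ, hθ⟩ : ∃ θ, θ = lam - 1 := ⟨_, rfl⟩
  obtain ⟨g, hg⟩ : ∃ g, g = γ * α := ⟨_, rfl⟩
  obtain ⟨L, hL⟩ : ∃ L, L = γ * ℓ := ⟨_, rfl⟩
  have hθ0 : 0 < θ := by linarith
  have hθμ : θ * (μ - 1) = 1 := by rw [hθ, h4]
  have hμθ : μ - 1 = θ⁻¹ := eq_inv_of_mul_eq_one_right hθμ
  have hg1 : 0 < 1 + 2 * g := by rw [hg]; linarith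
  have hμg : μ ≤ 2 + 2 * g := by rw [hg]; linarith
  have hL0 : 0 ≤ L := by rw [hL]; exact mul_nonneg hγ.le ((abs_nonneg α).trans hαℓ)
  have hD : 0 < 1 + 2 * g + L ^ 2 := by positivity
  have hDeq : 1 + 2 * γ * α + γ ^ 2 * ℓ ^ 2 = 1 + 2 * g + L ^ 2 := by rw [hg, hL]; ring
  have hδβ : δ * β = θ * (γ * β) := by rw [h5, hθ]; ring
  have hk' : 1 + θ ≤ 2 * (1 + δ * β) := by
    have : 0 ≤ θ * (μ - (2 - 2 * γ * β)) := mul_nonneg hθ0.le (by linarith)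
    linarith
  have hk : 0 < 1 + δ * β := by linarith
  have hε0 : 0 ≤ ε := div_nonneg (by linarith) (by linarith)
  have hεk : ε * (2 * (1 + δ * β)) = μ - (2 - 2 * γ * β) := div_mul_cancel₀ _ (by positivity)
  have hεθ : 1 + θ = 2 * (1 + δ * β) * (1 - ε * θ) := by
    have : θ * (ε * (2 * (1 + δ * β))) = θ * (μ - (2 - 2 * γ * β)) := by rw [hεk]
    linarith
  have hν : 0 < 1 - ε * θ := by
    by_contra! h
    nlinarith
  have hε₁0 : 0 ≤ ε₁ := div_nonneg (mul_nonneg hκ0.le hε0) hκ1'.le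
  have hε₁ : (1 - κ) * ε₁ = κ * ε := mul_div_cancel₀ _ hκ1'.ne'
  obtain ⟨c, hc⟩ : ∃ c, c = 1 + ε₁ * θ := ⟨_, rfl⟩
  obtain ⟨e, he⟩ : ∃ e, e = ε₁ * lam := ⟨_, rfl⟩
  have hc0 : 0 < c := by rw [hc]; positivity
  have he0 : 0 ≤ e := by rw [he]; positivity
  have hψ : 0 < 2 * c * (1 + g) - e := by
    have : 0 ≤ θ * (2 + 2 * g - μ) := mul_nonneg hθ0.le (by linarith)
    have h' : 0 ≤ ε₁ * (θ * (1 + 2 * g) - 1) := mul_nonneg hε₁0 (by linarith)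
    have hl : lam = θ + 1 := by linarith
    rw [hc, he, hl]
    linarith
  have hφ : φ = e * (2 * c * (1 + g) - e) := by
    simp only [φ, he, hc, hg, hθ]
    ring
  have hαJ0 : 0 < αJ := by
    simp only [αJ]
    split_ifs
    · rw [hDeq]; positivity
    · rw [← hg, ← hL]
      have : 0 < 1 + g := by linarith
      positivity
  have hρ : ρ = (1 - κ) * Real.sqrt (c ^ 2 - φ * αJ) + κ * (1 - ε * θ) *
      Real.sqrt (1 - μ * (2 + 2 * g - μ) / (1 + 2 * g + L ^ 2)) := by
    simp only [ρ, hc, hθ]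
    rw [hDeq, hg, mul_assoc 2 γ α]
  have hρ0 : 0 ≤ ρ := by rw [hρ]; positivity
  have hρ1 : ρ < 1 := by
    have hφα : 0 ≤ φ * αJ := by rw [hφ]; positivity
    have hq : 0 ≤ μ * (2 + 2 * g - μ) / (1 + 2 * g + L ^ 2) :=
      div_nonneg (mul_nonneg (by linarith) (by linarith)) hD.le
    have s1 : Real.sqrt (c ^ 2 - φ * αJ) ≤ c := Real.sqrt_le_iff.2 ⟨hc0.le, by linarith⟩
    have s2 : Real.sqrt (1 - μ * (2 + 2 * g - μ) / (1 + 2 * g + L ^ 2)) ≤ 1 :=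
      Real.sqrt_le_one.2 (by linarith)
    have hsum : (1 - κ) * c + κ * (1 - ε * θ) * 1 = 1 := by
      rw [hc]
      linear_combination θ * hε₁
    have hκν : 0 < κ * (1 - ε * θ) := by positivity
    refine lt_of_lt_of_eq ?_ hsum
    rw [hρ]
    rcases hε0.eq_or_lt with h0 | hpos
    · have hlt : μ < 2 + 2 * g := by
        rw [← h0, zero_mul] at hεk
        have := mul_pos hγ hαβ
        rw [hg]
        linarith
      refine add_lt_add_of_le_of_lt (mul_le_mul_of_nonneg_left s1 hκ1'.le)
        (mul_lt_mul_of_pos_left ?_ hκν)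
      have : 0 < μ * (2 + 2 * g - μ) / (1 + 2 * g + L ^ 2) :=
        div_pos (mul_pos (by linarith) (by linarith)) hD
      exact (Real.sqrt_lt' one_pos).2 (by linarith)
    · refine add_lt_add_of_lt_of_le (mul_lt_mul_of_pos_left ?_ hκ1')
        (mul_le_mul_of_nonneg_left s2 hκν.le)
      have hε₁pos : 0 < ε₁ := div_pos (mul_pos hκ0 hpos) hκ1'
      have he_pos : 0 < e := by rw [he]; positivity
      have : 0 < φ * αJ := by rw [hφ]; positivity
      exact (Real.sqrt_lt' hc0).2 (by linarith)
  have hlip : ∀ x y : X, ‖T x - T y‖ ≤ ρ * ‖x - y‖ := by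
    intro x y
    obtain ⟨a, ha⟩ : ∃ a, a = J₁ x - J₁ y := ⟨_, rfl⟩
    obtain ⟨b, hb⟩ : ∃ b, b = γ • (A (J₁ x) - A (J₁ y)) := ⟨_, rfl⟩
    obtain ⟨d, hd⟩ : ∃ d, d = x - y := ⟨_, rfl⟩
    have hdab : d = a + b := by
      have : x - y = (J₁ x + γ • A (J₁ x)) - (J₁ y + γ • A (J₁ y)) := by rw [hJ₁, hJ₁]
      rw [hd, ha, hb, this]
      module
    have hab : g * ‖a‖ ^ 2 ≤ ⟪a, b⟫ := by
      rw [hb, real_inner_smul_right, ha, hg, mul_assoc]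
      exact mul_le_mul_of_nonneg_left (hAmono _ _) hγ.le
    have hbL : ‖b‖ ≤ L * ‖a‖ := by
      rw [hb, norm_smul, Real.norm_of_nonneg hγ.le, ha, hL, mul_assoc]
      exact mul_le_mul_of_nonneg_left (hAlip _ _) hγ.le
    have hbL2 : ‖b‖ ^ 2 ≤ L ^ 2 * ‖a‖ ^ 2 := by
      rw [← mul_pow]
      exact pow_le_pow_left₀ (norm_nonneg _) hbL 2
    have habL : ⟪a, b⟫ ≤ L * ‖a‖ ^ 2 := by
      calc ⟪a, b⟫ ≤ ‖a‖ * ‖b‖ := real_inner_le_norm a b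
        _ ≤ ‖a‖ * (L * ‖a‖) := mul_le_mul_of_nonneg_left hbL (norm_nonneg a)
        _ = L * ‖a‖ ^ 2 := by ring
    have hdn : ‖d‖ ^ 2 = ‖a‖ ^ 2 + 2 * ⟪a, b⟫ + ‖b‖ ^ 2 := by
      rw [hdab, norm_add_sq_real]
    obtain ⟨r, hr⟩ : ∃ r, r = R₁ x - R₁ y := ⟨_, rfl⟩
    have hrab : r = a - θ • b := by
      have : r = (-θ) • d + (θ + 1) • a := by
        rw [hr, hR₁, hR₁, hd, ha, hθ]
        module
      rw [this, hdab]
      module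
    obtain ⟨p, hp⟩ : ∃ p, p = J₂ (R₁ x) - J₂ (R₁ y) := ⟨_, rfl⟩
    obtain ⟨q, hq⟩ : ∃ q, q = r - p := ⟨_, rfl⟩
    have hpq : p + q = r := by rw [hq]; abel
    have hinner : (1 + δ * β) * ‖p‖ ^ 2 ≤ ⟪p, p + q⟫ := by
      obtain ⟨u, hu, hu'⟩ := Set.mem_smul_set.1 (hJ₂ (R₁ x))
      obtain ⟨v, hv, hv'⟩ := Set.mem_smul_set.1 (hJ₂ (R₁ y))
      have hq' : q = δ • (u - v) := by
        rw [smul_sub, hu', hv', hq, hr, hp]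
        abel
      have := mul_le_mul_of_nonneg_left (hB.1 hu hv) hδ.le
      rw [inner_add_right, real_inner_self_eq_norm_sq, hq', real_inner_smul_right, hp]
      linarith
    have hball := norm_relaxed_resolvent_add_le hθ0 hk hεθ hinner
    have hs : R₂ (R₁ x) - R₂ (R₁ y) = p - θ⁻¹ • q := by
      rw [hR₂, hR₂, hq, ← hμθ, hr, hp]
      module
    rw [hpq] at hball
    have hrn : ‖θ⁻¹ • r‖ ≤
        Real.sqrt (1 - μ * (2 + 2 * g - μ) / (1 + 2 * g + L ^ 2)) * ‖d‖ := by
      apply norm_le_sqrt_mul_norm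
      have hkey := relaxed_resolvent_scalar_bound hab hbL2 hμ hμg
      rw [← hdn] at hkey
      have e1 : θ⁻¹ • r = (μ - 1) • a - b := by
        rw [hrab, smul_sub, smul_smul, inv_mul_cancel₀ hθ0.ne', one_smul, hμθ]
      have e2 : ‖θ⁻¹ • r‖ ^ 2 = ‖d‖ ^ 2 - μ * (2 * ⟪a, b⟫ + (2 - μ) * ‖a‖ ^ 2) := by
        rw [e1, norm_sub_sq_real, norm_smul, mul_pow, Real.norm_eq_abs, sq_abs,
          real_inner_smul_left, hdn]
        ring
      have e3 : (2 + 2 * g - μ) / (1 + 2 * g + L ^ 2) * ‖d‖ ^ 2 ≤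
          2 * ⟪a, b⟫ + (2 - μ) * ‖a‖ ^ 2 := by
        rw [div_mul_eq_mul_div, div_le_iff₀ hD]
        linarith
      rw [e2, mul_div_assoc]
      linarith [mul_le_mul_of_nonneg_left e3 (by linarith : 0 ≤ μ)]
    have hdr : ‖d - ε₁ • r‖ ≤ Real.sqrt (c ^ 2 - φ * αJ) * ‖d‖ := by
      apply norm_le_sqrt_mul_norm
      have e1 : d - ε₁ • r = c • d - e • a := by
        have hl : lam = θ + 1 := by linarith
        rw [hrab, hc, he, hl, hdab]
        module
      have e2 : ‖d - ε₁ • r‖ ^ 2 = c ^ 2 * ‖d‖ ^ 2 -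
          e * (2 * c * (‖a‖ ^ 2 + ⟪a, b⟫) - e * ‖a‖ ^ 2) := by
        have : ⟪d, a⟫ = ‖a‖ ^ 2 + ⟪a, b⟫ := by
          rw [hdab, inner_add_left, real_inner_self_eq_norm_sq, real_inner_comm]
        rw [e1, norm_sub_sq_real, norm_smul, norm_smul, mul_pow, mul_pow, Real.norm_eq_abs,
          Real.norm_eq_abs, sq_abs, sq_abs, real_inner_smul_left, real_inner_smul_right, this]
        ring
      have e3 : (2 * c * (1 + g) - e) * αJ * ‖d‖ ^ 2 ≤
          2 * c * (‖a‖ ^ 2 + ⟪a, b⟫) - e * ‖a‖ ^ 2 := by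
        simp only [αJ]
        rw [← hL, ← hg, hDeq]
        split_ifs with hL1
        · have := resolvent_scalar_bound_of_one_le hab hbL2 hL1 hc0.le he0 hψ.le
          rw [mul_one_div, div_mul_eq_mul_div, div_le_iff₀ hD, hdn]
          exact this
        · have := resolvent_scalar_bound_of_le_one hab hbL2 habL hL0 (not_le.1 hL1).le he0 hψ.le
          have hpos : 0 < (1 + g) * (1 + L) := mul_pos (by linarith) (by linarith)
          rw [mul_one_div, div_mul_eq_mul_div, div_le_iff₀ hpos, hdn]
          exact this
      rw [e2, hφ]
      linarith [mul_le_mul_of_nonneg_left e3 he0]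
    have hTd : T x - T y =
        (1 - κ) • (d - ε₁ • r) + κ • (p - θ⁻¹ • q + ε • r) := by
      have : T x - T y = (1 - κ) • d + κ • (R₂ (R₁ x) - R₂ (R₁ y)) := by
        rw [hT, hT, hd]
        module
      rw [this, hs, smul_sub (1 - κ) d, smul_smul (1 - κ) ε₁, hε₁]
      module
    have hs' : ‖p - θ⁻¹ • q + ε • r‖ ≤ (1 - ε * θ) * ‖θ⁻¹ • r‖ := by
      rw [norm_smul, Real.norm_of_nonneg (by positivity), ← mul_assoc, mul_comm _ θ⁻¹, mul_assoc,
        ← div_eq_inv_mul, le_div_iff₀ hθ0]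
      linarith
    calc ‖T x - T y‖ ≤ (1 - κ) * ‖d - ε₁ • r‖ + κ * ‖p - θ⁻¹ • q + ε • r‖ := by
          rw [hTd]
          refine (norm_add_le _ _).trans_eq ?_
          rw [norm_smul, norm_smul, Real.norm_of_nonneg hκ1'.le, Real.norm_of_nonneg hκ0.le]
      _ ≤ (1 - κ) * (Real.sqrt (c ^ 2 - φ * αJ) * ‖d‖) + κ * ((1 - ε * θ) *
          (Real.sqrt (1 - μ * (2 + 2 * g - μ) / (1 + 2 * g + L ^ 2)) * ‖d‖)) := by
          gcongr
          exact hs'.trans (mul_le_mul_of_nonneg_left hrn hν.le)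
      _ = ρ * ‖x - y‖ := by
          rw [hρ, hd]
          ring
  exact ⟨hlip, hρ1, exists_fixedPoint_of_norm_sub_le hρ0 hρ1 hlip⟩
end

section
/- Let X be a real Hilbert space. Suppose A: X → X is monotone (i.e., ⟨x − y, Ax − Ay⟩ ≥ 0 for all x, y) and Lipschitz continuous with constant ℓ, B: X ⇒ X is maximally β-monotone with β > 0, and zer(A+B) := {x : −A x ∈ B x} is nonempty. Let γ > 0, let J₁: X → X satisfy J₁x + γ·A(J₁x) = x for all x, let J₂: X → X satisfy x − J₂x ∈ γ·B(J₂x) for all x, and define the classical Douglas–Rachford operator T := (1/2)·Id + (1/2)·(2J₂ − Id)∘(2J₁ − Id). Then T is Lipschitz continuous with constant ρ := (1/(2(1+γβ)))·(√((1+2γβ)² − 4γβ(1+γβ)·min{1/(1+γℓ), 1/(1+γ²ℓ²)}) + 1), and ρ < 1. Furthermore, if the monotonicity of A is strengthened to ⟨x − y, Ax − Ay⟩ = 0 for all x, y ∈ X, then T is Lipschitz continuous with the improved constant ρ̄ := (1/(2(1+γβ)))·(√((1+2γβ)² − 4γβ(1+γβ)/(1+γ²ℓ²)) + 1) < 1.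 -/
open Pointwise RealInnerProductSpace Filter

variable {X : Type*} [NormedAddCommGroup X] [InnerProductSpace ℝ X]

/-- The ball that contains `b` when `s * ‖b‖ ^ 2 ≤ ⟪b, r⟫`. -/
lemma norm_smul_sub_le_of_mul_norm_sq_le_inner {b r : X} {s : ℝ} (hs : 0 < s)
    (h : s * ‖b‖ ^ 2 ≤ ⟪b, r⟫) : ‖(2 * s) • b - r‖ ≤ ‖r‖ := by
  refine le_of_sq_le_sq ?_ (norm_nonneg r)
  rw [norm_sub_sq_real, norm_smul, Real.norm_of_nonneg (by positivity), real_inner_smul_left]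
  nlinarith [mul_le_mul_of_nonneg_left h hs.le]

/-- The Lipschitz estimate for the Douglas–Rachford operator in terms of the resolvent
increments `a`, `b` and the operator increment `u`, where `m` is the strong monotonicity
modulus of the first resolvent. -/
lemma norm_add_le_of_resolvent_increments {a u b : X} {κ m : ℝ} (hκ : 0 < κ)
    (hau : 0 ≤ ⟪a, u⟫) (hm : m * ‖a + u‖ ^ 2 ≤ ‖a‖ ^ 2 + ⟪a, u⟫)
    (hb : (1 + κ) * ‖b‖ ^ 2 ≤ ⟪b, a - u⟫) :
    ‖u + b‖ ≤ (1 / (2 * (1 + κ))) *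
      (Real.sqrt ((1 + 2 * κ) ^ 2 - 4 * κ * (1 + κ) * m) + 1) * ‖a + u‖ := by
  have hball := norm_smul_sub_le_of_mul_norm_sq_le_inner (by positivity) hb
  have hrefl : ‖a - u‖ ≤ ‖a + u‖ := by
    refine le_of_sq_le_sq ?_ (norm_nonneg _)
    rw [norm_sub_sq_real, norm_add_sq_real]
    linarith
  have hcenter : ‖a + (1 + 2 * κ) • u‖ ≤
      Real.sqrt ((1 + 2 * κ) ^ 2 - 4 * κ * (1 + κ) * m) * ‖a + u‖ := by
    rw [← Real.sqrt_sq (norm_nonneg (a + u)), ← Real.sqrt_mul' _ (sq_nonneg _)]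
    refine Real.le_sqrt_of_sq_le ?_
    have h₁ := mul_le_mul_of_nonneg_left hm (show 0 ≤ 4 * κ * (1 + κ) by positivity)
    have h₂ : 0 ≤ κ ^ 2 * ⟪a, u⟫ := by positivity
    have hd := norm_add_sq_real a u
    have he := norm_add_sq_real a ((1 + 2 * κ) • u)
    rw [norm_smul, Real.norm_of_nonneg (by positivity), real_inner_smul_right] at he
    rw [sub_mul, he]
    have h₃ : (1 + 2 * κ) ^ 2 * ‖a + u‖ ^ 2 =
        (1 + 2 * κ) ^ 2 * (‖a‖ ^ 2 + 2 * ⟪a, u⟫ + ‖u‖ ^ 2) := by rw [hd]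
    nlinarith [mul_nonneg hκ.le hau]
  have hsum : (2 * (1 + κ)) • (u + b) =
      (a + (1 + 2 * κ) • u) + ((2 * (1 + κ)) • b - (a - u)) := by
    module
  have hle : 2 * (1 + κ) * ‖u + b‖ ≤
      (Real.sqrt ((1 + 2 * κ) ^ 2 - 4 * κ * (1 + κ) * m) + 1) * ‖a + u‖ := by
    have := norm_add_le (a + (1 + 2 * κ) • u) ((2 * (1 + κ)) • b - (a - u))
    rw [← hsum, norm_smul, Real.norm_of_nonneg (by positivity)] at this
    linarith
  rw [mul_assoc, one_div, ← div_eq_inv_mul, le_div_iff₀' (by positivity)]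
  exact hle

lemma douglasRachford_constant_lt_one {κ m : ℝ} (hκ : 0 < κ) (hm : 0 < m) :
    (1 / (2 * (1 + κ))) *
      (Real.sqrt ((1 + 2 * κ) ^ 2 - 4 * κ * (1 + κ) * m) + 1) < 1 := by
  have h : Real.sqrt ((1 + 2 * κ) ^ 2 - 4 * κ * (1 + κ) * m) < 1 + 2 * κ := by
    rw [Real.sqrt_lt' (by positivity)]
    have : 0 < 4 * κ * (1 + κ) * m := by positivity
    linarith
  rw [one_div, ← div_eq_inv_mul, div_lt_one (by positivity)]
  linarith

/-- Strong monotonicity of the resolvent of a monotone `t`-Lipschitz operator. -/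
lemma mul_norm_add_sq_le_of_norm_le {a u : X} {t m : ℝ} (hau : 0 ≤ ⟪a, u⟫)
    (hu : ‖u‖ ≤ t * ‖a‖) (hm₀ : 0 ≤ m) (hm₁ : m * (1 + t) ≤ 1) (hm₂ : m * (1 + t ^ 2) ≤ 1)
    (ht : 0 ≤ t) : m * ‖a + u‖ ^ 2 ≤ ‖a‖ ^ 2 + ⟪a, u⟫ := by
  have hsq : ‖u‖ ^ 2 ≤ t ^ 2 * ‖a‖ ^ 2 := by
    rw [← mul_pow]
    gcongr
  have hcs : ⟪a, u⟫ ≤ t * ‖a‖ ^ 2 := by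
    have := mul_le_mul_of_nonneg_left hu (norm_nonneg a)
    linarith [real_inner_le_norm a u]
  have hmsq := mul_le_mul_of_nonneg_left hsq hm₀
  rw [norm_add_sq_real]
  rcases le_total (2 * m) 1 with h | h
  · nlinarith [mul_nonneg (sub_nonneg.2 h) hau,
      mul_le_mul_of_nonneg_right hm₂ (sq_nonneg ‖a‖)]
  · nlinarith [mul_le_mul_of_nonneg_left hcs (sub_nonneg.2 h),
      mul_le_mul_of_nonneg_right (mul_le_mul_of_nonneg_right hm₁ (by positivity : 0 ≤ 1 + t))
        (sq_nonneg ‖a‖)]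

lemma mul_norm_add_sq_le_of_inner_eq_zero {a u : X} {t m : ℝ} (hau : ⟪a, u⟫ = 0)
    (hu : ‖u‖ ≤ t * ‖a‖) (hm₀ : 0 ≤ m) (hm : m * (1 + t ^ 2) ≤ 1) :
    m * ‖a + u‖ ^ 2 ≤ ‖a‖ ^ 2 + ⟪a, u⟫ := by
  have hsq : ‖u‖ ^ 2 ≤ t ^ 2 * ‖a‖ ^ 2 := by
    rw [← mul_pow]
    gcongr
  rw [norm_add_sq_real, hau]
  nlinarith [mul_le_mul_of_nonneg_left hsq hm₀, mul_le_mul_of_nonneg_right hm (sq_nonneg ‖a‖)]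

lemma AlphaMonotone.mul_norm_sq_le_inner_resolvent {B : X → Set X} {β γ : ℝ}
    (hB : AlphaMonotone β B) (hγ : 0 ≤ γ) {J : X → X} (hJ : ∀ x, x - J x ∈ γ • B (J x))
    (x y : X) : (1 + γ * β) * ‖J x - J y‖ ^ 2 ≤ ⟪J x - J y, x - y⟫ := by
  obtain ⟨p, hp, hpx⟩ := Set.mem_smul_set.1 (hJ x)
  obtain ⟨q, hq, hqy⟩ := Set.mem_smul_set.1 (hJ y)
  have h := mul_le_mul_of_nonneg_left (hB hp hq) hγ
  have hxy : x - y = (J x - J y) + γ • (p - q) := by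
    rw [smul_sub, hpx, hqy]
    abel
  rw [hxy, inner_add_right, real_inner_smul_right, real_inner_self_eq_norm_sq]
  linarith

theorem stmt19 [CompleteSpace X] (A : X → X) (B : X → Set X) (β ℓ : ℝ)
    (hAmono : ∀ x y : X, 0 ≤ ⟪x - y, A x - A y⟫)
    (hℓ : 0 ≤ ℓ) (hAlip : ∀ x y : X, ‖A x - A y‖ ≤ ℓ * ‖x - y‖)
    (hB : MaxAlphaMonotone β B) (hβ : 0 < β)
    (hzer : ∃ z : X, -A z ∈ B z)
    (γ : ℝ) (hγ : 0 < γ)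
    (J₁ : X → X) (hJ₁ : ∀ x, J₁ x + γ • A (J₁ x) = x)
    (J₂ : X → X) (hJ₂ : ∀ x, x - J₂ x ∈ γ • B (J₂ x))
    (T : X → X)
    (hT : ∀ z, T z = (1 / 2 : ℝ) • z +
      (1 / 2 : ℝ) • ((2 : ℝ) • J₂ ((2 : ℝ) • J₁ z - z) - ((2 : ℝ) • J₁ z - z))) :
    let ρ : ℝ := (1 / (2 * (1 + γ * β))) *
      (Real.sqrt ((1 + 2 * γ * β) ^ 2 -
          4 * γ * β * (1 + γ * β) *
            min (1 / (1 + γ * ℓ)) (1 / (1 + γ ^ 2 * ℓ ^ 2))) + 1)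
    let ρ' : ℝ := (1 / (2 * (1 + γ * β))) *
      (Real.sqrt ((1 + 2 * γ * β) ^ 2 -
          4 * γ * β * (1 + γ * β) / (1 + γ ^ 2 * ℓ ^ 2)) + 1)
    (∀ x y : X, ‖T x - T y‖ ≤ ρ * ‖x - y‖) ∧ ρ < 1 ∧
      ((∀ x y : X, ⟪x - y, A x - A y⟫ = 0) →
        (∀ x y : X, ‖T x - T y‖ ≤ ρ' * ‖x - y‖) ∧ ρ' < 1) := by
  intro ρ ρ'
  have hκ : 0 < γ * β := mul_pos hγ hβ
  have ht : 0 ≤ γ * ℓ := mul_nonneg hγ.le hℓ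
  set m := min (1 / (1 + γ * ℓ)) (1 / (1 + γ ^ 2 * ℓ ^ 2))
  have hm₀ : 0 < m := lt_min (by positivity) (by positivity)
  have hm₁ : m * (1 + γ * ℓ) ≤ 1 := (le_div_iff₀ (by positivity)).1 (min_le_left _ _)
  have hm₂ : m * (1 + (γ * ℓ) ^ 2) ≤ 1 := by
    rw [mul_pow]
    exact (le_div_iff₀ (by positivity)).1 (min_le_right _ _)
  have hρ : ρ = (1 / (2 * (1 + γ * β))) *
      (Real.sqrt ((1 + 2 * (γ * β)) ^ 2 - 4 * (γ * β) * (1 + γ * β) * m) + 1) := by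
    simp only [ρ, m, mul_assoc]
  have hρ' : ρ' = (1 / (2 * (1 + γ * β))) *
      (Real.sqrt ((1 + 2 * (γ * β)) ^ 2 -
        4 * (γ * β) * (1 + γ * β) * (1 / (1 + γ ^ 2 * ℓ ^ 2))) + 1) := by
    simp only [ρ', mul_assoc, mul_one_div, mul_div_assoc]
  have hstep (x y : X) (m : ℝ)
      (h : m * ‖(J₁ x - J₁ y) + γ • (A (J₁ x) - A (J₁ y))‖ ^ 2 ≤
        ‖J₁ x - J₁ y‖ ^ 2 + ⟪J₁ x - J₁ y, γ • (A (J₁ x) - A (J₁ y))⟫) :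
      ‖T x - T y‖ ≤ (1 / (2 * (1 + γ * β))) *
        (Real.sqrt ((1 + 2 * (γ * β)) ^ 2 - 4 * (γ * β) * (1 + γ * β) * m) + 1) *
          ‖x - y‖ := by
    have hxy : x - y = (J₁ x - J₁ y) + γ • (A (J₁ x) - A (J₁ y)) := by
      rw [smul_sub]
      nth_rewrite 1 [← hJ₁ x, ← hJ₁ y]
      abel
    have hr : ((2 : ℝ) • J₁ x - x) - ((2 : ℝ) • J₁ y - y) =
        (J₁ x - J₁ y) - γ • (A (J₁ x) - A (J₁ y)) := by
      rw [show ((2 : ℝ) • J₁ x - x) - ((2 : ℝ) • J₁ y - y) =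
        (2 : ℝ) • (J₁ x - J₁ y) - (x - y) by module, hxy]
      module
    have hTxy : T x - T y = γ • (A (J₁ x) - A (J₁ y)) +
        (J₂ ((2 : ℝ) • J₁ x - x) - J₂ ((2 : ℝ) • J₁ y - y)) := by
      rw [eq_sub_of_add_eq' hxy.symm, hT, hT]
      module
    have hb := hB.1.mul_norm_sq_le_inner_resolvent hγ.le hJ₂
      ((2 : ℝ) • J₁ x - x) ((2 : ℝ) • J₁ y - y)
    rw [hr] at hb
    rw [hTxy, hxy]
    refine norm_add_le_of_resolvent_increments hκ ?_ h hb
    rw [real_inner_smul_right]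
    exact mul_nonneg hγ.le (hAmono _ _)
  have hlip (x y : X) : ‖γ • (A x - A y)‖ ≤ γ * ℓ * ‖x - y‖ := by
    rw [norm_smul, Real.norm_of_nonneg hγ.le, mul_assoc]
    exact mul_le_mul_of_nonneg_left (hAlip x y) hγ.le
  refine ⟨fun x y => ?_, ?_, fun hskew => ⟨fun x y => ?_, ?_⟩⟩
  · rw [hρ]
    refine hstep x y m (mul_norm_add_sq_le_of_norm_le ?_ (hlip _ _) hm₀.le hm₁ hm₂ ht)
    rw [real_inner_smul_right]
    exact mul_nonneg hγ.le (hAmono _ _)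
  · rw [hρ]
    exact douglasRachford_constant_lt_one hκ hm₀
  · rw [hρ']
    refine hstep x y _ (mul_norm_add_sq_le_of_inner_eq_zero ?_ (hlip _ _) (by positivity) ?_)
    · rw [real_inner_smul_right, hskew, mul_zero]
    · rw [mul_pow, one_div_mul_cancel (by positivity)]
  · rw [hρ']
    exact douglasRachford_constant_lt_one hκ (by positivity)
end
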